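/- arXiv:2106.00004 — 5 statements merged into one kernel-verified Lean document; each statement's English description precedes it below -/
import Mathlib

section
/- Let f(x) = x^n − m ∈ ℤ[x] be a monic irreducible polynomial with n ≥ 2 such that ν_p(m) < n for every prime p, let α be a complex root of f, and let K = ℚ(α). Then ℤ[α] equals the ring of integers 𝓞_K of K if and only if ν_p(m^p − m) = 1 for every prime integer p dividing n·m. -/
open Polynomial

theorem geom_coprime {R : Type*} [CommRing R] (p c δ g a b : R) (q : ℕ)
    (h : δ ^ q = p * (c + δ * g)) (hc : c * a + p * b = 1) :
    ∃ w t : R, (c + δ * g) * w = 1 + p * t := by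
  have h1 : (1 - (p * b - a * (δ * g))) ∣ 1 - (p * b - a * (δ * g)) ^ q := by
    simpa using sub_dvd_pow_sub_pow (1 : R) (p * b - a * (δ * g)) q
  have h2 : p ∣ (p * b - a * (δ * g)) ^ q := by
    have h3 : p ∣ (p * b - a * (δ * g)) ^ q - (-(a * (δ * g))) ^ q := by
      refine Dvd.dvd.trans ?_ (sub_dvd_pow_sub_pow _ _ q)
      exact ⟨b, by ring⟩
    have h4 : p ∣ (-(a * (δ * g))) ^ q := by
      refine ⟨(c + δ * g) * (-(a * g)) ^ q, ?_⟩
      rw [← mul_assoc p, ← h, ← mul_pow]; congr 1; ring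
    exact (dvd_iff_dvd_of_dvd_sub h3).2 h4
  obtain ⟨y, hy⟩ := h1
  obtain ⟨t, ht⟩ := h2
  refine ⟨a * y, -t, ?_⟩
  have : (c + δ * g) * (a * y) = (1 - (p * b - a * (δ * g))) * y := by
    linear_combination y * hc
  rw [this, ← hy, ht]; ring

theorem integral_mul_pow {R K : Type*} [CommRing R] [Field K] [Algebra R K]
    (hinj : Function.Injective (algebraMap R K)) (z : K) (hz : IsIntegral R z) (δ y : R)
    (hy : z * algebraMap R K δ = algebraMap R K y) : ∃ (N : ℕ) (c : R), y ^ N = δ * c := by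
  obtain ⟨P, hP, hPz⟩ := hz
  have h0 : eval₂ (algebraMap R K) z P = 0 := hPz
  rw [eval₂_eq_sum_range, Finset.sum_range_succ, hP.coeff_natDegree, map_one, one_mul] at h0
  refine ⟨P.natDegree,
    -∑ i ∈ Finset.range P.natDegree, P.coeff i * y ^ i * δ ^ (P.natDegree - i - 1), hinj ?_⟩
  rw [map_pow, ← hy, mul_pow, eq_neg_of_add_eq_zero_right h0, mul_neg, map_neg, neg_mul,
    Finset.mul_sum, map_sum, Finset.sum_mul]
  congr 1
  refine Finset.sum_congr rfl fun i hi => ?_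
  have hi' := Finset.mem_range.1 hi
  simp only [map_mul, map_pow, ← hy, mul_pow]
  obtain ⟨k, hk⟩ : ∃ k, P.natDegree = i + k + 1 := ⟨P.natDegree - i - 1, by omega⟩
  have : P.natDegree - i - 1 = k := by omega
  rw [this, hk]; ring

theorem p_maximal {R K : Type*} [CommRing R] [Field K] [Algebra R K]
    (hinj : Function.Injective (algebraMap R K)) (p c δ g a b : R) (q : ℕ) (hq : 1 ≤ q)
    (hδ : δ ≠ 0)
    (h : δ ^ q = p * (c + δ * g)) (hc : c * a + p * b = 1)
    (hrad : ∀ (y : R) (N : ℕ), (∃ b c, y ^ N = p * b + δ * c) → ∃ b c, y = p * b + δ * c)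
    (x : K) (hx : IsIntegral R x) (hpx : ∃ y, x * algebraMap R K p = algebraMap R K y) :
    ∃ y, x = algebraMap R K y := by
  obtain ⟨w, t, hwt⟩ := geom_coprime p c δ g a b q h hc
  obtain ⟨y0, hy0⟩ := hpx
  have key : ∀ j : ℕ, (∃ y, x * algebraMap R K (δ ^ j) = algebraMap R K y) →
      ∃ y, x = algebraMap R K y := by
    intro j
    induction j with
    | zero => rintro ⟨y, hy⟩; exact ⟨y, by simpa using hy⟩
    | succ j ih =>
      rintro ⟨y, hy⟩
      apply ih
      have hy' : (x * algebraMap R K (δ ^ j)) * algebraMap R K δ = algebraMap R K y := by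
        rw [← hy, pow_succ, map_mul, mul_assoc]
      obtain ⟨N, e, he⟩ := integral_mul_pow hinj _ (hx.mul isIntegral_algebraMap) δ y hy'
      obtain ⟨b', c', hbc⟩ := hrad y N ⟨0, e, by rw [he]; ring⟩
      have hδ' : algebraMap R K δ ≠ 0 := by
        rw [Ne, ← map_zero (algebraMap R K)]; exact fun h => hδ (hinj h)
      obtain ⟨q, rfl⟩ : ∃ k, q = k + 1 := ⟨q - 1, by omega⟩
      have hzu : (x * algebraMap R K (δ ^ j)) * algebraMap R K (c + δ * g) =
          algebraMap R K (δ ^ q * b' + c' * (c + δ * g)) := by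
        apply mul_right_cancel₀ hδ'
        have e1 : y * (c + δ * g) = (δ ^ q * b' + c' * (c + δ * g)) * δ := by
          rw [hbc]; linear_combination - b' * h
        rw [mul_right_comm, hy', ← map_mul, ← map_mul, e1]
      refine ⟨(δ ^ q * b' + c' * (c + δ * g)) * w - y0 * δ ^ j * t, ?_⟩
      rw [map_sub, map_mul, ← hzu, map_mul _ _ t, map_mul _ y0, ← hy0]
      have := congrArg (algebraMap R K) hwt
      rw [map_mul, map_add _ 1, map_one, map_mul _ p] at this
      linear_combination -(x * algebraMap R K (δ ^ j)) * this
  apply key q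
  refine ⟨y0 * (c + δ * g), ?_⟩
  rw [h, map_mul, ← mul_assoc, hy0, map_mul]

theorem val_one_iff (p : ℕ) (hp : p.Prime) (a : ℤ) :
    padicValInt p a = 1 ↔ (p : ℤ) ∣ a ∧ ¬ (p : ℤ) ^ 2 ∣ a := by
  have := Fact.mk hp
  have h1 := padicValInt_dvd_iff (p := p) 1 a
  have h2 := padicValInt_dvd_iff (p := p) 2 a
  rw [pow_one] at h1
  rw [h1, h2]
  by_cases h : a = 0
  · simp [h]
  · simp only [h, false_or]; omega

theorem fermat_dvd (p : ℕ) (hp : p.Prime) (m : ℤ) : (p : ℤ) ∣ m ^ p - m := by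
  have := Fact.mk hp
  rw [← ZMod.intCast_zmod_eq_zero_iff_dvd]; simp

theorem sq_dvd_pow_sub (p : ℕ) (hp : p.Prime) (m : ℤ) (k : ℕ) :
    (p : ℤ) ^ 2 ∣ m ^ (p ^ (k + 1)) - m ^ p := by
  induction k with
  | zero => simp
  | succ k ih =>
    have h1 : (p : ℤ) ∣ m ^ (p ^ (k + 1)) - m := by
      have := (dvd_pow_self (p : ℤ) two_ne_zero).trans ih
      have := dvd_add this (fermat_dvd p hp m)
      simpa using this
    have := dvd_sub_pow_of_dvd_sub h1 1
    rw [pow_one, ← pow_mul, ← pow_succ] at this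
    exact_mod_cast this

theorem lift_dvd (p : ℕ) (h A : ℤ[X])
    (hd : h.map (Int.castRingHom (ZMod p)) ∣ A.map (Int.castRingHom (ZMod p))) :
    ∃ b c : ℤ[X], A = (p : ℤ[X]) * b + h * c := by
  obtain ⟨c, hc⟩ := hd
  obtain ⟨c, rfl⟩ := Polynomial.map_surjective (Int.castRingHom (ZMod p))
    (ZMod.ringHom_surjective _) c
  have h0 : (A - h * c).map (Int.castRingHom (ZMod p)) = 0 := by
    rw [Polynomial.map_sub, Polynomial.map_mul, hc, sub_self]
  have h1 : C (p : ℤ) ∣ A - h * c := by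
    rw [C_dvd_iff_dvd_coeff]
    intro i
    have := congrArg (fun P => P.coeff i) h0
    rw [← ZMod.intCast_zmod_eq_zero_iff_dvd]
    simpa only [coeff_map, coeff_zero, eq_intCast] using this
  obtain ⟨b, hb⟩ := h1
  refine ⟨b, c, ?_⟩
  have : (C (p : ℤ) : ℤ[X]) = (p : ℤ[X]) := by simp
  rw [← this, ← hb]; ring

theorem rad_lemma {R : Type*} [CommRing R] (φ : ℤ[X] →+* R) (hs : Function.Surjective φ)
    (f : ℤ[X]) (hker : ∀ A, φ A = 0 → f ∣ A) (p : ℕ) [Fact p.Prime] (h : ℤ[X])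
    (hsq : Squarefree (h.map (Int.castRingHom (ZMod p))))
    (hdvd : h.map (Int.castRingHom (ZMod p)) ∣ f.map (Int.castRingHom (ZMod p)))
    (y : R) (N : ℕ) (hy : ∃ b c, y ^ N = (p : R) * b + φ h * c) :
    ∃ b c, y = (p : R) * b + φ h * c := by
  obtain ⟨b, c, hy⟩ := hy
  obtain ⟨A, rfl⟩ := hs y
  obtain ⟨B, rfl⟩ := hs b
  obtain ⟨D, rfl⟩ := hs c
  have h1 : f ∣ A ^ N - (p * B + h * D) := hker _ (by simp [hy])
  have h2 := hdvd.trans (Polynomial.map_dvd (Int.castRingHom (ZMod p)) h1)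
  have h3 : h.map (Int.castRingHom (ZMod p)) ∣ A.map (Int.castRingHom (ZMod p)) ^ N := by
    simp only [Polynomial.map_sub, Polynomial.map_add, Polynomial.map_mul, Polynomial.map_pow,
      Polynomial.map_natCast, CharP.cast_eq_zero, zero_mul, zero_add] at h2
    exact (dvd_iff_dvd_of_dvd_sub h2).2 (dvd_mul_right _ _)
  obtain ⟨b, c, hbc⟩ := lift_dvd p h A (hsq.isRadical N _ h3)
  exact ⟨φ b, φ c, by rw [hbc]; simp⟩

theorem dvd_of_aeval {K : Type*} [Field K] [CharZero K] (f : ℤ[X]) (hf : f.Monic)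
    (hirr : Irreducible f) (α : K) (hα : aeval α f = 0) (A : ℤ[X]) (hA : aeval α A = 0) :
    f ∣ A := by
  have hint : IsIntegral ℤ α := ⟨f, hf, hα⟩
  have h1 := minpoly.isIntegrallyClosed_dvd hint hα
  exact ((minpoly.irreducible hint).dvd_symm hirr h1).trans
    (minpoly.isIntegrallyClosed_dvd hint hA)

theorem not_mem {K : Type*} [Field K] [CharZero K] (f : ℤ[X]) (hf : f.Monic)
    (hirr : Irreducible f) (α : K) (hα : aeval α f = 0) (p : ℕ) (hp : p.Prime) (P : ℤ[X])
    (hP : P.Monic) (hdeg : P.degree < f.degree) (x : K) (hx : (p : K) * x = aeval α P) :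
    x ∉ Algebra.adjoin ℤ {α} := by
  intro hmem
  rw [Algebra.adjoin_singleton_eq_range_aeval] at hmem
  obtain ⟨Q, hQ⟩ := hmem
  have hQ' : aeval α Q = x := hQ
  have h1 : f ∣ P - C (p : ℤ) * (Q %ₘ f) := by
    apply dvd_of_aeval f hf hirr α hα
    have : aeval α (Q %ₘ f) = x := by
      rw [← hQ', modByMonic_eq_sub_mul_div, map_sub, map_mul, hα]; simp
    rw [map_sub, map_mul, this, ← hx]; simp
  have h2 : P - C (p : ℤ) * (Q %ₘ f) = 0 := by
    apply Polynomial.eq_zero_of_dvd_of_degree_lt h1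
    refine (degree_sub_le _ _).trans_lt (max_lt hdeg ?_)
    rw [degree_C_mul (by exact_mod_cast hp.ne_zero)]
    exact degree_modByMonic_lt Q hf
  have h3 := congrArg (fun A => A.coeff P.natDegree) h2
  simp only [coeff_sub, hP.coeff_natDegree, coeff_C_mul, coeff_zero] at h3
  have : (p : ℤ) ∣ 1 := ⟨_, sub_eq_zero.1 h3⟩
  have := Int.natCast_dvd_natCast.1 (by exact_mod_cast this : (p : ℤ) ∣ ((1 : ℕ) : ℤ))
  exact hp.one_lt.ne' (Nat.dvd_one.1 this)

theorem exists_denom {K : Type*} [Field K] [NumberField K] (α : K)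
    (hgen : Algebra.adjoin ℚ {α} = ⊤) (x : K) :
    ∃ d : ℕ, d ≠ 0 ∧ (d : K) * x ∈ Algebra.adjoin ℤ {α} := by
  have hx : x ∈ Algebra.adjoin ℚ {α} := by rw [hgen]; trivial
  induction hx using Algebra.adjoin_induction with
  | mem x hx => exact ⟨1, one_ne_zero, by simpa using Algebra.subset_adjoin hx⟩
  | algebraMap r =>
    refine ⟨r.den, r.den_nz, ?_⟩
    have : (r.den : K) * algebraMap ℚ K r = algebraMap ℤ K r.num := by
      have h := Rat.den_mul_eq_num r
      have := congrArg (algebraMap ℚ K) h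
      rwa [map_mul, map_natCast, map_intCast] at this
    rw [this]
    exact Subalgebra.algebraMap_mem _ _
  | add x y _ _ hx hy =>
    obtain ⟨d, hd, h1⟩ := hx
    obtain ⟨e, he, h2⟩ := hy
    refine ⟨d * e, mul_ne_zero hd he, ?_⟩
    have : ((d * e : ℕ) : K) * (x + y) = e * (d * x) + d * (e * y) := by push_cast; ring
    rw [this]
    exact add_mem (mul_mem (natCast_mem _ _) h1) (mul_mem (natCast_mem _ _) h2)
  | mul x y _ _ hx hy =>
    obtain ⟨d, hd, h1⟩ := hx
    obtain ⟨e, he, h2⟩ := hy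
    refine ⟨d * e, mul_ne_zero hd he, ?_⟩
    have : ((d * e : ℕ) : K) * (x * y) = (d * x) * (e * y) := by push_cast; ring
    rw [this]
    exact mul_mem h1 h2

/-- The integral element `δ ^ (p-1) / p`. -/
theorem integral_theta {K : Type*} [Field K] [CharZero K] (p : ℕ) (hp : p.Prime) (m : ℤ)
    (hm : (p : ℤ) ^ 2 ∣ m ^ p - m) (β : K) (hβ : IsIntegral ℤ β) (h : β ^ p = m) :
    IsIntegral ℤ ((β - m) ^ (p - 1) / p) := by
  obtain ⟨c, hc⟩ := hm
  let B := integralClosure ℤ K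
  let b : B := ⟨β, hβ⟩
  have hb : b ^ p = (m : B) := Subtype.ext (by simpa [b] using h)
  obtain ⟨g, hg⟩ := (Commute.all (b - (m : B)) (m : B)).exists_add_pow_prime_eq hp
  have hpK : (p : K) ≠ 0 := by exact_mod_cast hp.ne_zero
  have hcK : ((m : K) ^ p - m) = p ^ 2 * c := by exact_mod_cast congrArg (Int.cast : ℤ → K) hc
  obtain ⟨k, rfl⟩ : ∃ k, p = k + 2 := ⟨p - 2, by have := hp.two_le; omega⟩
  rw [sub_add_cancel, hb] at hg
  have hgK : (m : K) = (β - m) ^ (k + 2) + m ^ (k + 2) +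
      ((k + 2 : ℕ) : K) * (β - m) * m * (g : K) := by
    have := congrArg (algebraMap B K) hg
    simp only [map_add, map_mul, map_pow, map_sub, map_natCast, map_intCast] at this
    exact this
  have hq : ∃ θ : K, θ = (β - m) ^ (k + 2 - 1) / ((k + 2 : ℕ) : K) := ⟨_, rfl⟩
  obtain ⟨θ, hθ⟩ := hq
  rw [← hθ]
  have hθ' : ((k + 2 : ℕ) : K) * θ = (β - m) ^ (k + 1) := by
    rw [hθ]; field_simp; rfl
  have hrel : θ ^ 2 + (m * g : K) * θ + c * (β - m) ^ k = 0 := by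
    apply (mul_right_injective₀ (pow_ne_zero 2 hpK))
    simp only [mul_zero]
    generalize ((k + 2 : ℕ) : K) = P at *
    have e : (P * θ) ^ 2 = (β - m) ^ (k + 2) * (β - m) ^ k := by rw [hθ']; ring
    have e2 : (β - (m : K)) * (β - m) ^ k = P * θ := by rw [hθ']; ring
    linear_combination e - (β - (m:K)) ^ k * hgK - (β - (m:K)) ^ k * hcK - P * m * g * e2
  have : IsIntegral B θ := by
    refine ⟨X ^ 2 + C ((m : B) * g) * X + C ((c : B) * (b - m) ^ k), by monicity!, ?_⟩
    rw [eval₂_add, eval₂_add, eval₂_C, eval₂_mul, eval₂_C]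
    simp only [eval₂_add, eval₂_mul, eval₂_pow, eval₂_X, eval₂_C, map_mul, map_pow, map_sub,
      map_intCast]
    exact hrel
  exact isIntegral_trans (R := ℤ) (A := B) θ this

theorem forward {K : Type*} [Field K] [NumberField K] (n : ℕ) (m : ℤ) (hn : 2 ≤ n)
    (hirr : Irreducible ((X : ℤ[X]) ^ n - C m))
    (α : K) (hroot : Polynomial.aeval α ((X : ℤ[X]) ^ n - C m) = 0)
    (heq : Algebra.adjoin ℤ {α} = integralClosure ℤ K)
    (p : ℕ) (hp : p.Prime) (hpd : (p : ℤ) ∣ (n : ℤ) * m) (h2 : (p : ℤ) ^ 2 ∣ m ^ p - m) :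
    False := by
  have hf : ((X : ℤ[X]) ^ n - C m).Monic := monic_X_pow_sub_C m (by omega)
  have hα : α ^ n = m := by simpa [sub_eq_zero] using hroot
  have hint : IsIntegral ℤ α := ⟨_, hf, hroot⟩
  have hpK : (p : K) ≠ 0 := by exact_mod_cast hp.ne_zero
  have hpi : Prime (p : ℤ) := Nat.prime_iff_prime_int.1 hp
  have key : ∀ P : ℤ[X], P.Monic → P.natDegree < n → IsIntegral ℤ (aeval α P / (p : K)) →
      False := by
    intro P hP hd hi
    refine not_mem _ hf hirr α hroot p hp P hP ?_ (aeval α P / (p : K)) (by field_simp) ?_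
    · rw [degree_X_pow_sub_C (by omega)]
      exact (degree_le_natDegree).trans_lt (by exact_mod_cast hd)
    · rw [heq]; exact hi
  by_cases hpm : (p : ℤ) ∣ m
  · have h3 : (p : ℤ) ^ 2 ∣ m := by
      have : (p : ℤ) ^ 2 ∣ m ^ p := (pow_dvd_pow_of_dvd hpm 2).trans (pow_dvd_pow _ hp.two_le)
      exact (dvd_sub_right this).1 h2
    obtain ⟨c, hc⟩ := h3
    refine key (X ^ (n - 1)) (monic_X_pow _) (by rw [natDegree_X_pow]; omega) ?_
    obtain ⟨k, rfl⟩ : ∃ k, n = k + 2 := ⟨n - 2, by omega⟩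
    refine IsIntegral.of_pow (n := k + 2) (by omega) ?_
    have : (aeval α (X ^ (k + 2 - 1) : ℤ[X]) / (p : K)) ^ (k + 2)
        = ((p ^ k * c ^ (k + 1) : ℤ) : K) := by
      rw [map_pow, aeval_X, div_pow, ← pow_mul, mul_comm, pow_mul, hα, hc]
      push_cast
      rw [div_eq_iff (pow_ne_zero _ hpK)]
      ring
    rw [this]
    exact isIntegral_algebraMap (R := ℤ) (A := K)
  · have hpn : p ∣ n := by
      have := (hpi.dvd_or_dvd hpd).resolve_right hpm
      exact_mod_cast this
    obtain ⟨s, rfl⟩ := hpn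
    have hs : 0 < s := by rcases Nat.eq_zero_or_pos s with rfl | h <;> omega
    refine key ((X ^ s - C m) ^ (p - 1)) ((monic_X_pow_sub_C m hs.ne').pow _) ?_ ?_
    · rw [natDegree_pow, natDegree_X_pow_sub_C]
      exact Nat.mul_lt_mul_of_pos_right (by have := hp.two_le; omega) hs
    · have := integral_theta p hp m h2 (α ^ s) (hint.pow s) (by rw [← pow_mul, mul_comm, hα])
      simpa using this

theorem backward_prime {K : Type*} [Field K] [NumberField K] (n : ℕ) (m : ℤ) (hn : 2 ≤ n)
    (hirr : Irreducible ((X : ℤ[X]) ^ n - C m))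
    (α : K) (hroot : Polynomial.aeval α ((X : ℤ[X]) ^ n - C m) = 0)
    (p : ℕ) (hp : p.Prime) (h : (p : ℤ) ∣ (n : ℤ) * m → ¬ (p : ℤ) ^ 2 ∣ m ^ p - m)
    (x : K) (hx : IsIntegral ℤ x) (hpx : (p : K) * x ∈ Algebra.adjoin ℤ {α}) :
    x ∈ Algebra.adjoin ℤ {α} := by
  have := Fact.mk hp
  have hf : ((X : ℤ[X]) ^ n - C m).Monic := monic_X_pow_sub_C m (by omega)
  have hα : α ^ n = m := by simpa [sub_eq_zero] using hroot
  have hpi : Prime (p : ℤ) := Nat.prime_iff_prime_int.1 hp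
  let R := Algebra.adjoin ℤ {α}
  have hinj : Function.Injective (algebraMap R K) := Subtype.val_injective
  let a : R := ⟨α, Algebra.self_mem_adjoin_singleton ℤ α⟩
  have ha : a ^ n = (m : R) := hinj (by rw [map_pow, map_intCast]; exact hα)
  let φ : ℤ[X] →+* R := (aeval a).toRingHom
  have hφv : ∀ A, algebraMap R K (φ A) = aeval α A := fun A =>
    (aeval_algebraMap_apply K a A).symm
  have hφX : φ X = a := aeval_X a
  have hs : Function.Surjective φ := by
    rintro ⟨y, hy⟩
    have hy' : y ∈ Algebra.adjoin ℤ {α} := hy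
    rw [Algebra.adjoin_singleton_eq_range_aeval] at hy'
    obtain ⟨A, hA⟩ := hy'
    exact ⟨A, hinj ((hφv A).trans hA)⟩
  have hker : ∀ A, φ A = 0 → ((X : ℤ[X]) ^ n - C m) ∣ A := fun A hA =>
    dvd_of_aeval _ hf hirr α hroot A (by rw [← hφv, hA, map_zero])
  have hp0 : (p : R) ≠ 0 := fun h0 => by
    have := congrArg (algebraMap R K) h0
    rw [map_natCast, map_zero] at this
    exact hp.ne_zero (by exact_mod_cast this)
  have hm0 : m ≠ 0 := by
    rintro rfl
    rw [map_zero, sub_zero] at hirr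
    exact not_irreducible_pow (by omega) hirr
  have rad := rad_lemma φ hs _ hker p
  have cop : ∀ c : ℤ, ¬ (p : ℤ) ∣ c → ∃ u v : R, (c : R) * u + (p : R) * v = 1 := by
    intro c hc
    have : IsCoprime (c : ℤ) (p : ℤ) := ((hpi.coprime_iff_not_dvd).2 hc).symm
    obtain ⟨u, v, huv⟩ := this
    refine ⟨u, v, ?_⟩
    have := congrArg (Int.cast : ℤ → R) huv
    push_cast at this
    linear_combination this
  have hxR : IsIntegral R x := hx.tower_top
  have hpx' : ∃ y, x * algebraMap R K (p : R) = algebraMap R K y :=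
    ⟨⟨_, hpx⟩, by rw [map_natCast, mul_comm]; rfl⟩
  suffices ∃ y, x = algebraMap R K y by
    obtain ⟨y, rfl⟩ := this
    exact y.2
  by_cases hpm : (p : ℤ) ∣ m
  · have h2 := h (hpm.mul_left _)
    obtain ⟨c, hc⟩ := hpm
    have hpc : ¬ (p : ℤ) ∣ c := by
      rintro ⟨d, rfl⟩
      apply h2
      have h3 : (p : ℤ) ^ 2 ∣ m := ⟨d, by rw [hc]; ring⟩
      exact dvd_sub (h3.trans (dvd_pow_self _ hp.ne_zero)) h3
    obtain ⟨u, v, huv⟩ := cop c hpc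
    refine p_maximal hinj (p : R) c a 0 u v n (by omega) ?_ ?_ huv ?_ x hxR hpx'
    · intro h0
      rw [h0, zero_pow (by omega)] at ha
      have := congrArg (algebraMap R K) ha
      rw [map_intCast, map_zero] at this
      exact hm0 (by exact_mod_cast this.symm)
    · rw [ha, hc]; push_cast; ring
    · rw [← hφX]
      refine rad X ?_ ?_
      · rw [Polynomial.map_X]; exact irreducible_X.squarefree
      · have : (m : ZMod p) = 0 := by rw [hc]; simp
        rw [Polynomial.map_sub, Polynomial.map_pow, Polynomial.map_X, Polynomial.map_C,
          eq_intCast, this, C_0, sub_zero]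
        exact dvd_pow_self _ (by omega)
  · have hmz : (m : ZMod p) ≠ 0 := by
      rwa [Ne, ZMod.intCast_zmod_eq_zero_iff_dvd]
    obtain ⟨k, r, hr, hnr⟩ := Nat.exists_eq_pow_mul_and_not_dvd (n := n) (by omega) p hp.ne_one
    have hrad := rad (X ^ r - C m) (by
        simp only [Polynomial.map_sub, Polynomial.map_pow, Polynomial.map_X, Polynomial.map_C]
        refine (separable_X_pow_sub_C' p r _ hr ?_).squarefree
        simpa using hmz) (by
        simp only [Polynomial.map_sub, Polynomial.map_pow, Polynomial.map_X, Polynomial.map_C]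
        have : (Int.castRingHom (ZMod p)) m = (Int.castRingHom (ZMod p)) m ^ p ^ k :=
          (ZMod.pow_card_pow _).symm
        rw [hnr, mul_comm, pow_mul]
        conv_rhs => rw [this, C_pow]
        exact sub_dvd_pow_sub_pow _ _ _)
    have hφh : φ (X ^ r - C m) = a ^ r - (m : R) := by
      rw [map_sub, map_pow, hφX]; simp
    rw [hφh] at hrad
    rcases k with _ | k
    · rw [pow_zero, one_mul] at hnr
      subst hnr
      rw [ha, sub_self] at hrad
      refine p_maximal hinj (p : R) 1 (p : R) 0 1 0 1 le_rfl hp0 (by ring) (by ring) ?_ x hxR hpx'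
      rintro y N ⟨b, c, hbc⟩
      obtain ⟨b', c', h'⟩ := hrad y N ⟨b + c, 0, by rw [hbc]; ring⟩
      exact ⟨b', 0, by rw [h']; ring⟩
    · have hpn : (p : ℤ) ∣ (n : ℤ) := by
        rw [hnr, pow_succ]
        exact Int.natCast_dvd_natCast.2 ((dvd_mul_left _ _).mul_right _)
      have h2 := h (hpn.mul_right m)
      have h3 := sq_dvd_pow_sub p hp m k
      have h4 : ¬ (p : ℤ) ^ 2 ∣ m ^ (p ^ (k + 1)) - m := by
        intro h5
        apply h2
        have := dvd_sub h5 h3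
        rwa [sub_sub_sub_cancel_left] at this
      obtain ⟨c, hc⟩ : (p : ℤ) ∣ m ^ (p ^ (k + 1)) - m := by
        rw [← ZMod.intCast_zmod_eq_zero_iff_dvd]
        push_cast
        rw [ZMod.pow_card_pow, sub_self]
      have hpc : ¬ (p : ℤ) ∣ -c := by
        rw [dvd_neg]
        rintro ⟨d, rfl⟩
        exact h4 ⟨d, by rw [hc]; ring⟩
      obtain ⟨u, v, huv⟩ := cop _ hpc
      obtain ⟨G, hG⟩ := (Commute.all (a ^ r - (m : R)) (m : R)).exists_add_pow_prime_pow_eq hp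
        (k + 1)
      rw [sub_add_cancel, ← pow_mul, mul_comm r, ← hnr, ha] at hG
      have hcR : (m : R) ^ (p ^ (k + 1)) - m = p * c := by
        exact_mod_cast congrArg (Int.cast : ℤ → R) hc
      have hq : p ^ (k + 1) ≠ 0 := pow_ne_zero _ hp.ne_zero
      have hrel : (a ^ r - (m : R)) ^ (p ^ (k + 1)) =
          (p : R) * (((-c : ℤ) : R) + (a ^ r - (m : R)) * (-(m * G))) := by
        rw [Int.cast_neg]
        linear_combination -hG - hcR
      refine p_maximal hinj (p : R) ((-c : ℤ) : R) (a ^ r - (m : R)) (-(m * G)) u v (p ^ (k + 1))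
        (Nat.one_le_iff_ne_zero.2 hq) ?_ hrel huv hrad x hxR hpx'
      intro h0
      rw [h0, zero_pow hq, zero_mul, add_zero] at hrel
      have h6 := (mul_eq_zero.1 hrel.symm).resolve_left hp0
      have h7 := congrArg (algebraMap R K) h6
      rw [map_intCast, map_zero] at h7
      have h8 : -c = 0 := by exact_mod_cast h7
      exact hpc (h8 ▸ dvd_zero _)

/-- **Theorem (integral closedness criterion).**
Let `f(x) = x^n - m ∈ ℤ[x]` be a monic irreducible polynomial with `n ≥ 2` such that
`ν_p(m) < n` for every prime `p`, let `α ∈ K` be a root of `f` generating the number field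
`K` over `ℚ`. Then `ℤ[α]` is the ring of integers of `K` if and only if
`ν_p(m^p - m) = 1` for every prime `p` dividing `n·m`. -/
theorem zalpha_eq_ringOfIntegers_iff
    {K : Type*} [Field K] [NumberField K] (n : ℕ) (m : ℤ) (hn : 2 ≤ n)
    (hirr : Irreducible ((X : ℤ[X]) ^ n - C m))
    (hval : ∀ p : ℕ, p.Prime → padicValInt p m < n)
    (α : K) (hroot : Polynomial.aeval α ((X : ℤ[X]) ^ n - C m) = 0)
    (hgen : Algebra.adjoin ℚ {α} = ⊤) :
    Algebra.adjoin ℤ {α} = integralClosure ℤ K ↔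
      ∀ p : ℕ, p.Prime → (p : ℤ) ∣ (n : ℤ) * m → padicValInt p (m ^ p - m) = 1 := by
  have hf : ((X : ℤ[X]) ^ n - C m).Monic := monic_X_pow_sub_C m (by omega)
  constructor
  · intro heq p hp hpd
    rw [val_one_iff p hp]
    exact ⟨fermat_dvd p hp m, fun h2 => forward n m hn hirr α hroot heq p hp hpd h2⟩
  · intro h
    apply le_antisymm
    · rw [Algebra.adjoin_le_iff, Set.singleton_subset_iff]
      exact ⟨_, hf, hroot⟩
    · intro x hx
      have hx' : IsIntegral ℤ x := hx
      obtain ⟨d, hd, hdx⟩ := exists_denom α hgen x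
      clear hx
      induction d using induction_on_primes generalizing x with
      | zero => exact absurd rfl hd
      | one => simpa using hdx
      | prime_mul p d hp ih =>
        have hd' : d ≠ 0 := by rintro rfl; simp at hd
        refine ih hx' hd' ?_
        refine backward_prime n m hn hirr α hroot p hp
          (fun hpd => ((val_one_iff p hp _).1 (h p hp hpd)).2) _ ?_ ?_
        · exact (isIntegral_algebraMap (R := ℤ) (A := K) (x := (d : ℤ))).mul hx' |> fun h => by simpa using h
        · rw [← mul_assoc]; exact_mod_cast hdx
end

section
/- Let a ∉ {1, −1} be a squarefree integer, let n ≥ 2, and let v be a positive integer coprime to n. Let f(x) = x^n − a^v ∈ ℤ[x] be irreducible and let K = ℚ(α) for a complex root α of f. If for every prime integer p dividing n, either p divides a or ν_p(a^{p−1} − 1) = 1, then K is monogenic. -/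
open Polynomial

/-- Abstract Dedekind-type criterion. -/
lemma mem_of_dedekind {S K : Type*} [CommRing S] [Field K] [Algebra S K]
    (hinj : Function.Injective (algebraMap S K)) (p π F : S) (hp : p ≠ 0) (q : ℕ) (hq : q ≠ 0)
    (hπ : π ^ q = p * F)
    (hrad : ∀ (y : S) (N : ℕ), (∃ c d, y ^ N = p * c + π * d) → ∃ c d, y = p * c + π * d)
    (hF : ∃ u c d, u * F = 1 + p * c + π * d)
    (x : K) (hx : IsIntegral S x) (hpx : ∃ s, algebraMap S K s = algebraMap S K p * x) :
    ∃ s, algebraMap S K s = x := by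
  have hpK : algebraMap S K p ≠ 0 := by
    rw [Ne, map_eq_zero_iff _ hinj]; exact hp
  -- integral multiples
  have key : ∀ (z : K), IsIntegral S z → ∀ (r s : S),
      algebraMap S K s = algebraMap S K r * z → ∃ N, r ∣ s ^ N := by
    intro z hz r s hs
    obtain ⟨P, hP, hPz⟩ := hz
    refine ⟨P.natDegree, ?_⟩
    have h1 : (P.scaleRoots r).eval s = 0 := by
      apply hinj
      rw [map_zero, ← Polynomial.eval₂_at_apply, hs, Polynomial.scaleRoots_eval₂_mul, hPz, mul_zero]
    have h2 : (P.scaleRoots r).eval s - s ^ P.natDegree =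
        ∑ i ∈ Finset.range P.natDegree, P.coeff i * r ^ (P.natDegree - i) * s ^ i := by
      rw [Polynomial.eval_eq_sum_range, Polynomial.natDegree_scaleRoots, Finset.sum_range_succ]
      simp [Polynomial.coeff_scaleRoots, hP.coeff_natDegree]
    have h3 : r ∣ (P.scaleRoots r).eval s - s ^ P.natDegree := by
      rw [h2]
      refine Finset.dvd_sum fun i hi => ?_
      have : P.natDegree - i ≠ 0 := by have := Finset.mem_range.1 hi; omega
      exact Dvd.dvd.mul_right (Dvd.dvd.mul_left (dvd_pow_self r this) _) _
    rw [h1, zero_sub, dvd_neg] at h3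
    exact h3
  obtain ⟨u, c₀, d₀, hu⟩ := hF
  by_cases hπ0 : π = 0
  · -- degenerate case
    obtain ⟨s, hs⟩ := hpx
    subst hπ0
    by_cases hF0 : F = 0
    · subst hF0
      refine ⟨-c₀ * s, ?_⟩
      have : p * c₀ = -1 := by linear_combination -hu
      have h' : algebraMap S K p * algebraMap S K c₀ = -1 := by rw [← map_mul, this]; simp
      rw [map_mul, hs, map_neg]
      linear_combination -x * h'
    · exfalso
      have h1 : algebraMap S K F ≠ 0 := by rw [Ne, map_eq_zero_iff _ hinj]; exact hF0
      rw [zero_pow hq] at hπ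
      have := congrArg (algebraMap S K) hπ
      simp [hpK, h1] at this
  have hπK : algebraMap S K π ≠ 0 := by
    rw [Ne, map_eq_zero_iff _ hinj]; exact hπ0
  have main : ∀ j, j ≤ q → ∃ y z, algebraMap S K (π ^ j * y + p * z) = algebraMap S K p * x := by
    intro j
    induction j with
    | zero =>
      intro _
      obtain ⟨s, hs⟩ := hpx
      exact ⟨s, 0, by simpa using hs⟩
    | succ j ih =>
      intro hj
      obtain ⟨y, z, hyz⟩ := ih (by omega)
      have hx' : IsIntegral S (x - algebraMap S K z) := hx.sub isIntegral_algebraMap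
      have e1 : algebraMap S K (F * y) = algebraMap S K (π ^ (q - j)) * (x - algebraMap S K z) := by
        have hq : π ^ q = π ^ (q - j) * π ^ j := by rw [← pow_add]; congr 1; omega
        have h1 := congrArg (algebraMap S K) hπ
        rw [hq] at h1
        simp only [map_mul, map_pow, map_add] at h1 hyz ⊢
        apply mul_left_cancel₀ hpK
        linear_combination (-algebraMap S K y) * h1 + algebraMap S K π ^ (q - j) * hyz
      obtain ⟨N, hN⟩ := key _ hx' _ _ e1
      obtain ⟨e, he⟩ := (dvd_pow_self π (show q - j ≠ 0 by omega)).trans hN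
      obtain ⟨c, d, hcd⟩ := hrad (F * y) N ⟨0, e, by rw [he]; ring⟩
      refine ⟨u * d - d₀ * y, z + π ^ j * (u * c - c₀ * y), ?_⟩
      rw [← hyz]
      congr 1
      linear_combination (-u * π ^ j) * hcd + π ^ j * y * hu
  obtain ⟨y, z, h⟩ := main q le_rfl
  refine ⟨F * y + z, mul_left_cancel₀ hpK ?_⟩
  rw [← h, hπ, ← map_mul]
  congr 1; ring

lemma radical_aux {S : Type*} [CommRing S] (t : S) (f h : ℤ[X]) (p : ℕ) [Fact p.Prime]
    (hsurj : ∀ s : S, ∃ g : ℤ[X], aeval t g = s)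
    (hker : ∀ g : ℤ[X], aeval t g = 0 → f ∣ g)
    (hsq : Squarefree (h.map (Int.castRingHom (ZMod p))))
    (hdvd : h.map (Int.castRingHom (ZMod p)) ∣ f.map (Int.castRingHom (ZMod p)))
    (y : S) (N : ℕ) (hy : ∃ c d, y ^ N = (p : S) * c + aeval t h * d) :
    ∃ c d, y = (p : S) * c + aeval t h * d := by
  obtain ⟨c, d, hy⟩ := hy
  obtain ⟨g, rfl⟩ := hsurj y
  obtain ⟨c, rfl⟩ := hsurj c
  obtain ⟨d, rfl⟩ := hsurj d
  have h1 : f ∣ g ^ N - ((p : ℤ[X]) * c + h * d) := hker _ (by simp [hy])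
  have h2 := Polynomial.map_dvd (Int.castRingHom (ZMod p)) h1
  have h3 : h.map (Int.castRingHom (ZMod p)) ∣ (g.map (Int.castRingHom (ZMod p))) ^ N := by
    have h4 := hdvd.trans h2
    simp only [Polynomial.map_sub, Polynomial.map_add, Polynomial.map_mul, Polynomial.map_pow,
      Polynomial.map_natCast, CharP.cast_eq_zero, zero_mul, zero_add] at h4
    exact (dvd_sub_left (dvd_mul_right _ _)).1 h4
  have h5 : h.map (Int.castRingHom (ZMod p)) ∣ g.map (Int.castRingHom (ZMod p)) := by
    rcases Nat.eq_zero_or_pos N with rfl | hN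
    · rw [pow_zero] at h3; exact h3.trans (one_dvd _)
    · exact (hsq.dvd_pow_iff_dvd hN.ne').1 h3
  obtain ⟨k, hk⟩ := h5
  obtain ⟨k, rfl⟩ := Polynomial.map_surjective (Int.castRingHom (ZMod p)) (ZMod.ringHom_surjective _) k
  have h6 : (C (p : ℤ)) ∣ g - h * k := by
    rw [Polynomial.C_dvd_iff_dvd_coeff]
    intro i
    have : ((g - h * k).map (Int.castRingHom (ZMod p))).coeff i = 0 := by
      simp [Polynomial.map_sub, hk]
    rw [Polynomial.coeff_map] at this
    exact (ZMod.intCast_zmod_eq_zero_iff_dvd _ _).1 (by simpa using this)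
  obtain ⟨e, he⟩ := h6
  refine ⟨aeval t e, aeval t k, ?_⟩
  have := congrArg (aeval t) (sub_eq_iff_eq_add.1 he)
  simpa using this

lemma local_mem {S K : Type*} [CommRing S] [Field K] [CharZero K] [Algebra S K]
    (hinj : Function.Injective (algebraMap S K)) (t : S) (n : ℕ) (a : ℤ) (hn : n ≠ 0)
    (ha : Squarefree a) (p : ℕ) (hp : p.Prime)
    (h : (p : ℤ) ∣ (n : ℤ) → (p : ℤ) ∣ a ∨ padicValInt p (a ^ (p - 1) - 1) = 1)
    (hsurj : ∀ s : S, ∃ g : ℤ[X], aeval t g = s)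
    (ht : t ^ n = (a : S))
    (hker : ∀ g : ℤ[X], aeval t g = 0 → (X ^ n - C a : ℤ[X]) ∣ g)
    (x : K) (hx : IsIntegral S x) (hpx : ∃ s, algebraMap S K s = (p : K) * x) :
    ∃ s, algebraMap S K s = x := by
  have : Fact p.Prime := ⟨hp⟩
  have hp0 : (p : S) ≠ 0 := by
    intro h0
    have := congrArg (algebraMap S K) h0
    simp [hp.ne_zero] at this
  have hpx' : ∃ s, algebraMap S K s = algebraMap S K (p : S) * x := by simpa using hpx
  have hpZ : Prime (p : ℤ) := Nat.prime_iff_prime_int.1 hp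
  by_cases hpa : (p : ℤ) ∣ a
  · obtain ⟨b, hb⟩ := hpa
    have hpb : ¬ (p : ℤ) ∣ b := by
      rintro ⟨c, rfl⟩
      exact hpZ.not_isUnit (ha p ⟨c, by rw [hb]; ring⟩)
    obtain ⟨u, w, huw⟩ := ((hpZ.coprime_iff_not_dvd).2 hpb)
    have haX : (a : ZMod p) = 0 := (ZMod.intCast_zmod_eq_zero_iff_dvd _ _).2 ⟨b, hb⟩
    refine mem_of_dedekind hinj (p : S) t (b : S) hp0 n hn (by rw [ht, hb]; simp) ?_ ?_ x hx hpx'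
    · intro y N hy
      have := radical_aux t (X ^ n - C a) X p hsurj hker
        (by rw [Polynomial.map_X]; exact Polynomial.prime_X.irreducible.squarefree)
        (by
          simp only [Polynomial.map_sub, Polynomial.map_pow, Polynomial.map_X, Polynomial.map_C]
          rw [show (Int.castRingHom (ZMod p)) a = 0 from haX, C_0, sub_zero]
          exact dvd_pow_self _ hn) y N (by simpa using hy)
      simpa using this
    · refine ⟨w, -u, 0, ?_⟩
      have := congrArg (Int.cast : ℤ → S) huw
      push_cast at this
      linear_combination this
  have haX : (a : ZMod p) ≠ 0 := fun h0 => hpa ((ZMod.intCast_zmod_eq_zero_iff_dvd _ _).1 h0)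
  by_cases hpn : p ∣ n
  · have hv := (h (by exact_mod_cast hpn)).resolve_left hpa
    obtain ⟨k, m, hm, hnm⟩ := Nat.exists_eq_pow_mul_and_not_dvd hn p hp.ne_one
    have hk : k ≠ 0 := by
      rintro rfl
      rw [pow_zero, one_mul] at hnm
      exact hm (hnm ▸ hpn)
    -- `a^(p^k) - a = p * b`, with `p` not dividing `b`
    have hnd : ¬ (p : ℤ) ^ 2 ∣ a ^ p ^ k - a := by
      have hnd1 : ¬ (p : ℤ) ^ 2 ∣ a ^ p - a := by
        intro hd
        have e : a ^ p - a = a * (a ^ (p - 1) - 1) := by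
          rw [mul_sub, ← pow_succ', Nat.sub_add_cancel hp.one_le, mul_one]
        rw [e] at hd
        have hd' : (p : ℤ) ^ 2 ∣ a ^ (p - 1) - 1 :=
          ((hpZ.coprime_iff_not_dvd.2 hpa).pow_left).dvd_of_dvd_mul_left hd
        rw [padicValInt_dvd_iff] at hd'
        rcases hd' with h0 | h0
        · rw [h0] at hv; simp at hv
        · omega
      have step : ∀ j, (p : ℤ) ^ 2 ∣ a ^ p ^ (j + 1) - a ^ p := by
        intro j
        induction j with
        | zero => simp
        | succ j ih =>
          have h1 : (p : ℤ) ∣ a ^ p ^ (j + 1) - a := by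
            rw [← ZMod.intCast_zmod_eq_zero_iff_dvd]
            simp
          have := dvd_sub_pow_of_dvd_sub (R := ℤ) (p := p) h1 1
          rw [← pow_mul, pow_one, ← pow_succ] at this
          exact this
      obtain ⟨j, rfl⟩ := Nat.exists_eq_succ_of_ne_zero hk
      intro hd
      apply hnd1
      have := dvd_sub hd (step j)
      simpa using this
    obtain ⟨b, hb⟩ : (p : ℤ) ∣ a ^ p ^ k - a := by
      rw [← ZMod.intCast_zmod_eq_zero_iff_dvd]
      simp
    have hpb : ¬ (p : ℤ) ∣ b := by
      rintro ⟨c, rfl⟩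
      exact hnd ⟨c, by rw [hb]; ring⟩
    obtain ⟨u, w, huw⟩ := ((hpZ.coprime_iff_not_dvd).2 hpb)
    have huw' := congrArg (Int.cast : ℤ → S) huw
    have hb' := congrArg (Int.cast : ℤ → S) hb
    push_cast at huw' hb'
    obtain ⟨r, hr⟩ := exists_add_pow_prime_pow_eq hp (a : S) (t ^ m - (a : S)) k
    have e1 : ((a : S) + (t ^ m - (a : S))) ^ p ^ k = a := by
      rw [add_sub_cancel, ← pow_mul, mul_comm, ← hnm, ht]
    refine mem_of_dedekind hinj (p : S) (t ^ m - (a : S)) (-(b + a * (t ^ m - (a : S)) * r)) hp0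
      (p ^ k) (pow_ne_zero _ hp.ne_zero) ?_ ?_ ?_ x hx hpx'
    · linear_combination -hb' - hr + e1
    · intro y N hy
      have := radical_aux t (X ^ n - C a) (X ^ m - C a) p hsurj hker
        (by
          have := separable_X_pow_sub_C' p m (a : ZMod p) hm haX
          simpa using this.squarefree)
        (by
          have e2 : (X ^ n - C (a : ZMod p) : (ZMod p)[X]) = (X ^ m - C (a : ZMod p)) ^ p ^ k := by
            rw [sub_pow_char_pow, ← C_pow, ← pow_mul, mul_comm, ← hnm, ZMod.pow_card_pow]
          simp only [Polynomial.map_sub, Polynomial.map_pow, Polynomial.map_X, Polynomial.map_C]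
          rw [show (Int.castRingHom (ZMod p)) a = (a : ZMod p) from rfl, e2]
          exact dvd_pow_self _ (pow_ne_zero _ hp.ne_zero)) y N (by simpa using hy)
      simpa using this
    · refine ⟨-w, -u, w * a * r, ?_⟩
      linear_combination huw'
  · refine mem_of_dedekind hinj (p : S) (p : S) 1 hp0 1 one_ne_zero (by simp) ?_ ?_ x hx hpx'
    · rintro y N ⟨c, d, hy⟩
      have := radical_aux t (X ^ n - C a) (X ^ n - C a) p hsurj hker
        (by
          have := separable_X_pow_sub_C' p n (a : ZMod p) hpn haX
          simpa using this.squarefree) dvd_rfl y N ⟨c + d, 0, by rw [hy]; ring⟩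
      obtain ⟨c, d, h⟩ := this
      exact ⟨c, 0, by rw [h]; simp [ht]⟩
    · exact ⟨1, 0, 0, by simp⟩

theorem monogenic_of_pow_sqfree
    {K : Type*} [Field K] [NumberField K] (n : ℕ) (a : ℤ) (v : ℕ)
    (ha : Squarefree a) (ha1 : a ≠ 1) (ha2 : a ≠ -1)
    (hn : 2 ≤ n) (hv : 0 < v) (hcop : Nat.Coprime v n)
    (hirr : Irreducible ((X : ℤ[X]) ^ n - C (a ^ v)))
    (α : K) (hroot : Polynomial.aeval α ((X : ℤ[X]) ^ n - C (a ^ v)) = 0)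
    (hgen : Algebra.adjoin ℚ {α} = ⊤)
    (h : ∀ p : ℕ, p.Prime → (p : ℤ) ∣ (n : ℤ) →
      (p : ℤ) ∣ a ∨ padicValInt p (a ^ (p - 1) - 1) = 1) :
    ∃ θ : NumberField.RingOfIntegers K, Algebra.adjoin ℤ {θ} = ⊤ := by
  have hn0 : n ≠ 0 := by omega
  have haK : (a : K) ≠ 0 := by exact_mod_cast ha.ne_zero
  have hα : α ^ n = (a : K) ^ v := by
    simpa [sub_eq_zero] using hroot
  -- the generator
  obtain ⟨u, hu⟩ : ∃ u, v * u % n = 1 := by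
    obtain ⟨u, hu⟩ := Nat.exists_mul_mod_eq_one_of_coprime hcop (by omega)
    exact ⟨u, hu.2⟩
  obtain ⟨k, hk⟩ : ∃ k, v * u = 1 + n * k := ⟨v * u / n, by
    have := Nat.mod_add_div (v * u) n; omega⟩
  set θ : K := α ^ u / (a : K) ^ k with hθ
  have hθn : θ ^ n = (a : K) := by
    rw [hθ, div_pow, ← pow_mul, mul_comm u n, pow_mul, hα, ← pow_mul, hk, pow_add, pow_one,
      ← pow_mul, mul_comm k n]
    field_simp
  have hθv : θ ^ v = α := by
    rw [hθ, div_pow, ← pow_mul, mul_comm u v, hk, pow_add, pow_one, pow_mul, hα, ← pow_mul,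
      ← pow_mul, mul_comm k v]
    field_simp
  have hgenθ : Algebra.adjoin ℚ {θ} = ⊤ := by
    rw [eq_top_iff, ← hgen]
    refine Algebra.adjoin_le ?_
    rintro _ rfl
    rw [SetLike.mem_coe, ← hθv]
    exact pow_mem (Algebra.self_mem_adjoin_singleton ℚ θ) v
  -- degrees
  have hdeg : ∀ β : K, Algebra.adjoin ℚ {β} = ⊤ → IsIntegral ℤ β →
      (minpoly ℤ β).natDegree = Module.finrank ℚ K := by
    intro β hβ hint
    have h1 := minpoly.isIntegrallyClosed_eq_field_fractions' ℚ hint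
    have h2 : (minpoly ℚ β).natDegree = (minpoly ℤ β).natDegree := by
      rw [h1, (minpoly.monic hint).natDegree_map]
    rw [← h2, ← Field.primitive_element_iff_minpoly_natDegree_eq, eq_top_iff]
    intro z _
    have : z ∈ Algebra.adjoin ℚ {β} := by rw [hβ]; trivial
    exact IntermediateField.algebra_adjoin_le_adjoin ℚ _ this
  have hmα : (X ^ n - C (a ^ v) : ℤ[X]).Monic := monic_X_pow_sub_C _ hn0
  have hmθ : (X ^ n - C a : ℤ[X]).Monic := monic_X_pow_sub_C _ hn0
  have hαi : IsIntegral ℤ α := ⟨_, hmα, hroot⟩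
  have hθr : aeval θ (X ^ n - C a : ℤ[X]) = 0 := by simp [hθn]
  have hθi : IsIntegral ℤ θ := ⟨_, hmθ, hθr⟩
  have hfin : Module.finrank ℚ K = n := by
    rw [← hdeg α hgen hαi]
    have hd := minpoly.isIntegrallyClosed_dvd hαi hroot
    have has := (hirr.dvd_iff.1 hd).resolve_left (minpoly.not_isUnit ℤ α)
    rw [← eq_of_monic_of_associated hmα (minpoly.monic hαi) has, natDegree_X_pow_sub_C]
  have hmin : minpoly ℤ θ = X ^ n - C a := by
    refine (eq_of_monic_of_dvd_of_natDegree_le (minpoly.monic hθi) hmθ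
      (minpoly.isIntegrallyClosed_dvd hθi hθr) ?_).symm
    rw [natDegree_X_pow_sub_C, hdeg θ hgenθ hθi, hfin]
  -- the order
  set S := Algebra.adjoin ℤ {θ} with hS
  let t : S := ⟨θ, Algebra.self_mem_adjoin_singleton ℤ θ⟩
  have hinj : Function.Injective (algebraMap S K) := Subtype.val_injective
  have hcoe : ∀ g : ℤ[X], ((aeval t g : S) : K) = aeval θ g := by
    intro g
    exact (aeval_algHom_apply S.val t g).symm
  have hsurj : ∀ s : S, ∃ g : ℤ[X], aeval t g = s := by
    rintro ⟨s, hs⟩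
    have hs' := hs
    rw [hS, Algebra.adjoin_singleton_eq_range_aeval] at hs'
    obtain ⟨g, hg⟩ := hs'
    exact ⟨g, Subtype.ext ((hcoe g).trans hg)⟩
  have ht : t ^ n = (a : S) := Subtype.ext (by simpa [t] using hθn)
  have hker : ∀ g : ℤ[X], aeval t g = 0 → (X ^ n - C a : ℤ[X]) ∣ g := by
    intro g hg
    rw [← hmin]
    apply minpoly.isIntegrallyClosed_dvd hθi
    rw [← hcoe, hg]; rfl
  have hloc : ∀ p : ℕ, p.Prime → ∀ x : K, IsIntegral ℤ x → (p : K) * x ∈ S → x ∈ S := by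
    intro p hp x hx hpx
    obtain ⟨s, hs⟩ := local_mem hinj t n a hn0 ha p hp (h p hp) hsurj ht hker x hx.tower_top
      ⟨⟨_, hpx⟩, rfl⟩
    rw [← hs]; exact s.2
  have hglob : ∀ d : ℕ, d ≠ 0 → ∀ x : K, IsIntegral ℤ x → (d : K) * x ∈ S → x ∈ S := by
    intro d
    induction d using induction_on_primes with
    | zero => intro h0; exact absurd rfl h0
    | one => intro _ x _ hx; simpa using hx
    | prime_mul p d hp ih =>
      intro h0 x hx hxS
      refine ih (by rintro rfl; simp at h0) x hx (hloc p hp _ ?_ ?_)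
      · exact (map_natCast (algebraMap ℤ K) d ▸ isIntegral_algebraMap : IsIntegral ℤ (d : K)).mul hx
      · rw [← mul_assoc]; exact_mod_cast hxS
  have hden : ∀ x : K, ∃ d : ℕ, d ≠ 0 ∧ (d : K) * x ∈ S := by
    intro x
    have hx : x ∈ Algebra.adjoin ℚ {θ} := by rw [hgenθ]; trivial
    induction hx using Algebra.adjoin_induction with
    | mem x hx =>
      obtain rfl := hx
      exact ⟨1, one_ne_zero, by
        rw [Nat.cast_one, one_mul]; exact Algebra.self_mem_adjoin_singleton ℤ θ⟩
    | algebraMap r =>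
      refine ⟨r.den, r.den_nz, ?_⟩
      have : (r.den : K) * algebraMap ℚ K r = ((r.num : ℤ) : K) := by
        have h1 := congrArg (algebraMap ℚ K) (Rat.den_mul_eq_num r)
        rwa [map_mul, map_natCast, map_intCast] at h1
      rw [this]
      exact intCast_mem S _
    | add x y _ _ hx hy =>
      obtain ⟨d, hd, hx⟩ := hx
      obtain ⟨e, he, hy⟩ := hy
      refine ⟨d * e, mul_ne_zero hd he, ?_⟩
      have : ((d * e : ℕ) : K) * (x + y) = e * (d * x) + d * (e * y) := by push_cast; ring
      rw [this]
      exact add_mem (mul_mem (natCast_mem S _) hx) (mul_mem (natCast_mem S _) hy)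
    | mul x y _ _ hx hy =>
      obtain ⟨d, hd, hx⟩ := hx
      obtain ⟨e, he, hy⟩ := hy
      refine ⟨d * e, mul_ne_zero hd he, ?_⟩
      have : ((d * e : ℕ) : K) * (x * y) = (d * x) * (e * y) := by push_cast; ring
      rw [this]
      exact mul_mem hx hy
  let T : NumberField.RingOfIntegers K := ⟨θ, hθi⟩
  refine ⟨T, ?_⟩
  rw [eq_top_iff]
  intro x _
  obtain ⟨d, hd, hdx⟩ := hden (x : K)
  have hxS := hglob d hd x (NumberField.RingOfIntegers.isIntegral_coe x) hdx
  rw [hS, Algebra.adjoin_singleton_eq_range_aeval] at hxS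
  obtain ⟨g, hg⟩ := hxS
  rw [Algebra.adjoin_singleton_eq_range_aeval]
  refine ⟨g, NumberField.RingOfIntegers.ext ?_⟩
  refine Eq.trans ?_ hg
  exact (aeval_algebraMap_apply K T g).symm
end

section
/- Let f(x) = x^n − m ∈ ℤ[x] be a monic irreducible polynomial with n ≥ 2, α a complex root of f, K = ℚ(α), and ind(f) = (𝓞_K : ℤ[α]). Let p be a prime with 1 ≤ ν_p(m) < n and set d = gcd(n, ν_p(m)). If p divides both n and ν_p(m) (i.e., gcd(p, ν_p(m), n) = p), then ν_p(ind(f)) > ((n−1)(ν_p(m)−1) + d − 1)/2. -/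
open Polynomial

/-- Triangular families of integral elements bound the index from below. -/
theorem index_lower {K : Type*} [Field K] [NumberField K] (n : ℕ)
    (θ : NumberField.RingOfIntegers K)
    (hdeg : (minpoly ℤ θ).natDegree = n)
    (hrank : Module.finrank ℤ (NumberField.RingOfIntegers K) = n)
    (p : ℕ) (hp : p.Prime) (g : Fin n → ℤ[X]) (hg : ∀ i, (g i).Monic)
    (hgd : ∀ i, (g i).natDegree = i) (c : Fin n → ℕ)
    (hdvd : ∀ i, (p : NumberField.RingOfIntegers K) ^ c i ∣ aeval θ (g i)) :
    ∑ i, c i ≤ padicValNat p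
        ((Subalgebra.toSubmodule (Algebra.adjoin ℤ {θ})).toAddSubgroup.index) := by
  classical
  have : Fact p.Prime := ⟨hp⟩
  choose u hu using hdvd
  have hint : IsIntegral ℤ θ := NumberField.RingOfIntegers.isIntegral θ
  let b : Module.Basis (Fin n) ℤ (NumberField.RingOfIntegers K) :=
    Module.finBasisOfFinrankEq ℤ _ hrank
  let pb := Algebra.adjoin.powerBasis' hint
  have hdim : pb.dim = n := hdeg
  let bN : Module.Basis (Fin n) ℤ (Algebra.adjoin ℤ {θ}) := pb.basis.reindex (finCongr hdim)
  have hbN : ∀ i, ((bN i : Algebra.adjoin ℤ {θ}) : NumberField.RingOfIntegers K) = θ ^ (i : ℕ) := by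
    intro i
    have h1 : bN i = pb.gen ^ (i : ℕ) := by
      rw [Module.Basis.reindex_apply, PowerBasis.basis_eq_pow]
      rfl
    rw [h1, Algebra.adjoin.powerBasis'_gen]
    rfl
  set N := (Subalgebra.toSubmodule (Algebra.adjoin ℤ {θ})) with hN
  have hidx : N.toAddSubgroup.index = (b.det (fun i : Fin n => θ ^ (i : ℕ))).natAbs := by
    rw [AddSubgroup.index_eq_natAbs_det b N.toAddSubgroup bN]
    congr 2
    ext i
    exact congrArg _ (hbN i)
  have hne : N.toAddSubgroup.index ≠ 0 := by
    obtain ⟨k, snf⟩ := N.smithNormalForm b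
    rw [snf.toAddSubgroup_index_ne_zero_iff]
    have h1 := Module.finrank_eq_card_basis snf.bN
    have h2 : Module.finrank ℤ N = Fintype.card (Fin n) := Module.finrank_eq_card_basis bN
    rw [← h2, h1, Fintype.card_fin]
  have hmat : b.toMatrix (fun i => aeval θ (g i)) =
      b.toMatrix (fun i : Fin n => θ ^ (i : ℕ)) *
        Matrix.of (fun (i j : Fin n) => (g j).coeff i) := by
    ext i j
    rw [Matrix.mul_apply, Module.Basis.toMatrix_apply,
      aeval_eq_sum_range' (n := n) (by rw [hgd]; exact j.2), ← Fin.sum_univ_eq_sum_range (fun k => (g j).coeff k • θ ^ k)]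
    rw [map_sum, Finsupp.finsetSum_apply]
    apply Finset.sum_congr rfl
    intro k _
    rw [map_smul, Finsupp.smul_apply, smul_eq_mul, mul_comm]
    rfl
  have hdet : b.det (fun i => aeval θ (g i)) = b.det (fun i : Fin n => θ ^ (i : ℕ)) := by
    rw [Module.Basis.det_apply, hmat, Matrix.det_mul, Matrix.det_matrixOfPolynomials g hgd hg,
      mul_one, Module.Basis.det_apply]
  have hdet2 : b.det (fun i => aeval θ (g i)) = (∏ i, (p : ℤ) ^ c i) * b.det u := by
    have : (fun i => aeval θ (g i)) = fun i => ((p : ℤ) ^ c i) • u i := by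
      ext i
      rw [hu i]
      simp
    rw [this, AlternatingMap.map_smul_univ, smul_eq_mul]
  have hd : p ^ (∑ i, c i) ∣ N.toAddSubgroup.index := by
    rw [hidx, ← hdet, hdet2, Finset.prod_pow_eq_pow_sum, Int.natAbs_mul, Int.natAbs_pow,
      Int.natAbs_natCast]
    exact dvd_mul_right _ _
  exact (padicValNat_dvd_iff_le hne).1 hd

theorem floor_sum (n v : ℕ) (hn : 2 ≤ n) (hv : 1 ≤ v) :
    ((n - 1) * (v - 1) + Nat.gcd n v - 1) / 2 ≤ ∑ j ∈ Finset.range n, (j * v / n) := by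
  obtain ⟨d, hd⟩ : ∃ d, d = Nat.gcd n v := ⟨_, rfl⟩
  have hdpos : 0 < d := hd ▸ Nat.gcd_pos_of_pos_left _ (by omega)
  obtain ⟨e, he⟩ : d ∣ n := hd ▸ Nat.gcd_dvd_left _ _
  obtain ⟨w, hw⟩ : d ∣ v := hd ▸ Nat.gcd_dvd_right _ _
  have hepos : 0 < e := by rcases Nat.eq_zero_or_pos e with h | h; · simp [h] at he; omega
                           · exact h
  rw [← hd]
  obtain ⟨N, rfl⟩ : ∃ N, n = N + 1 := ⟨n - 1, by omega⟩
  rw [Finset.sum_range_succ']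
  simp only [zero_mul, Nat.zero_div, add_zero, Nat.add_sub_cancel]
  set S := ∑ k ∈ Finset.range N, (k + 1) * v / (N + 1) with hS
  have h2 : ∑ k ∈ Finset.range N, (N - k) * v / (N + 1) = S := by
    rw [hS, ← Finset.sum_range_reflect]
    apply Finset.sum_congr rfl
    intro k hk
    have := Finset.mem_range.1 hk
    congr 2; omega
  have hcount : d - 1 ≤ ((Finset.range N).filter (fun k => (N + 1) ∣ (k + 1) * v)).card := by
    rw [← Finset.card_range (d - 1)]
    apply Finset.card_le_card_of_injOn (fun k => (k + 1) * e - 1)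
    · intro k hk
      have hk : k < d - 1 := by simpa using hk
      have h1 : (k + 1) * e ≥ 1 := Nat.mul_pos (by omega) hepos
      have h3 : (k + 1) * e + e ≤ d * e := by
        calc (k + 1) * e + e = (k + 2) * e := by ring
          _ ≤ d * e := Nat.mul_le_mul_right _ (by omega)
      simp only [Finset.coe_filter, Finset.mem_range, Set.mem_ofPred_eq]
      refine ⟨by omega, ?_⟩
      rw [Nat.sub_add_cancel h1, he, hw]
      exact ⟨(k + 1) * w, by ring⟩
    · intro a _ b _ hab
      have h1 : (a + 1) * e ≥ 1 := Nat.mul_pos (by omega) hepos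
      have h3 : (b + 1) * e ≥ 1 := Nat.mul_pos (by omega) hepos
      have : (a + 1) * e = (b + 1) * e := by simp only at hab; omega
      have := Nat.eq_of_mul_eq_mul_right hepos this
      omega
  have hterm : ∀ k ∈ Finset.range N, (v - 1) + (if (N + 1) ∣ (k + 1) * v then 1 else 0) ≤
      (k + 1) * v / (N + 1) + (N - k) * v / (N + 1) := by
    intro k hk
    have hk := Finset.mem_range.1 hk
    have hsum : (k + 1) * v + (N - k) * v = v * (N + 1) := by
      rw [← add_mul, mul_comm]; congr 1; omega
    generalize (k + 1) * v = A at *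
    generalize (N - k) * v = B at *
    split_ifs with h
    · obtain ⟨q, rfl⟩ := h
      have hB : B = (N + 1) * (v - q) := by
        rw [Nat.mul_sub]; rw [mul_comm v] at hsum; omega
      have hq : q ≤ v := by
        by_contra hc
        have : (N + 1) * v < (N + 1) * q := Nat.mul_lt_mul_of_pos_left (by omega) (by omega)
        rw [mul_comm v] at hsum; omega
      rw [hB, Nat.mul_div_cancel_left _ (by omega), Nat.mul_div_cancel_left _ (by omega)]
      omega
    · have h1 := Nat.div_add_mod A (N + 1)
      have h3 := Nat.div_add_mod B (N + 1)
      have h4 := Nat.mod_lt A (show N + 1 > 0 by omega)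
      have h5 := Nat.mod_lt B (show N + 1 > 0 by omega)
      by_contra hc
      have : A / (N + 1) + B / (N + 1) + 2 ≤ v := by omega
      have := Nat.mul_le_mul_left (N + 1) this
      rw [mul_add, mul_add] at this
      rw [mul_comm v] at hsum
      omega
  have := Finset.sum_le_sum hterm
  rw [Finset.sum_add_distrib, Finset.sum_add_distrib, h2, ← hS, Finset.sum_const,
    Finset.card_range, smul_eq_mul, ← Finset.card_filter] at this
  omega

/-- The extra integral element. -/
theorem extra_dvd {R : Type*} [CommRing R] [IsDomain R] [CharZero R] [IsIntegrallyClosed R]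
    (θ : R) (p n' v' j : ℕ) (m' : ℤ) (hp : p.Prime) (hn' : 0 < n')
    (hθ : θ ^ (p * n') = (p : R) ^ (p * v') * (m' : R)) (hj : n' ≤ 2 * (j * v')) :
    (p : R) ^ ((p - 1) * v' + 1) ∣ θ ^ j * (θ ^ n' - (m' : R) * (p : R) ^ v') ^ (p - 1) := by
  have hp0 : (p : R) ≠ 0 := by exact_mod_cast hp.ne_zero
  obtain ⟨ψ, hψ⟩ : (p : R) ^ v' ∣ θ ^ n' := by
    rw [← IsIntegrallyClosed.pow_dvd_pow_iff hp.ne_zero, ← pow_mul, ← pow_mul, mul_comm n', hθ,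
      mul_comm v']
    exact dvd_mul_right _ _
  have hψp : ψ ^ p = m' := by
    have h : (p : R) ^ (p * v') * ψ ^ p = (p : R) ^ (p * v') * (m' : R) := by
      rw [← hθ, mul_comm p n', pow_mul θ, hψ, mul_pow, ← pow_mul, mul_comm v']
    exact mul_left_cancel₀ (pow_ne_zero _ hp0) h
  have hη : (p : R) ∣ (ψ - m') ^ p := by
    obtain ⟨r, hr⟩ := exists_add_pow_prime_eq hp ψ (-(m' : R))
    have hf : (p : ℤ) ∣ m' + (-m') ^ p := by
      have : Fact p.Prime := ⟨hp⟩
      rw [← ZMod.intCast_zmod_eq_zero_iff_dvd]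
      push_cast
      rw [ZMod.pow_card]
      ring
    obtain ⟨s, hs⟩ := hf
    have hs' : (m' : R) + (-(m' : R)) ^ p = p * s := by exact_mod_cast congrArg (Int.cast (R := R)) hs
    rw [sub_eq_add_neg, hr, hψp, hs']
    exact ⟨s + ψ * -(m' : R) * r, by ring⟩
  have hθp : (p : R) ∣ θ ^ (j * p) := by
    rw [← IsIntegrallyClosed.pow_dvd_pow_iff hn'.ne']
    have : (θ ^ (j * p)) ^ n' = (p : R) ^ (p * v' * j) * (m' : R) ^ j := by
      rw [← pow_mul, mul_assoc, mul_comm j, pow_mul, hθ, mul_pow, ← pow_mul]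
    rw [this]
    apply Dvd.dvd.mul_right
    apply pow_dvd_pow
    have := Nat.mul_le_mul_right (j * v') hp.two_le
    calc n' ≤ _ := hj
      _ ≤ _ := this
      _ = _ := by ring
  have hx : (p : R) ∣ θ ^ j * (ψ - m') ^ (p - 1) := by
    rw [← IsIntegrallyClosed.pow_dvd_pow_iff hp.ne_zero, mul_pow, ← pow_mul, ← pow_mul,
      mul_comm (p - 1) p, pow_mul (ψ - (m' : R))]
    have h1 := mul_dvd_mul hθp (pow_dvd_pow_of_dvd hη (p - 1))
    rwa [← pow_succ', Nat.sub_add_cancel hp.one_le] at h1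
  have he : θ ^ j * (θ ^ n' - (m' : R) * (p : R) ^ v') ^ (p - 1) =
      (p : R) ^ ((p - 1) * v') * (θ ^ j * (ψ - m') ^ (p - 1)) := by
    rw [hψ, mul_comm (m' : R), ← mul_sub, mul_pow, ← pow_mul, mul_comm v']
    ring
  rw [he, pow_succ]
  exact mul_dvd_mul_left _ hx

/-- Let `f(x) = x^n - m` be monic irreducible, `n ≥ 2`, `θ ∈ 𝓞_K` a root of `f` generating
`K = ℚ(θ)`, and `ind(f) = (𝓞_K : ℤ[θ])`. Let `p` be a prime with `1 ≤ ν_p(m) < n` and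
`d = gcd(n, ν_p(m))`. If `p` divides both `n` and `ν_p(m)`, then
`ν_p(ind(f)) > ((n-1)(ν_p(m)-1) + d - 1)/2`. -/
theorem padicValNat_index_gt
    {K : Type*} [Field K] [NumberField K] (n : ℕ) (m : ℤ) (hn : 2 ≤ n)
    (hirr : Irreducible ((X : ℤ[X]) ^ n - C m))
    (θ : NumberField.RingOfIntegers K)
    (hroot : Polynomial.aeval θ ((X : ℤ[X]) ^ n - C m) = 0)
    (hgen : Algebra.adjoin ℚ {(θ : K)} = ⊤)
    (p : ℕ) (hp : p.Prime)
    (hv1 : 1 ≤ padicValInt p m) (hvn : padicValInt p m < n)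
    (hpn : p ∣ n) (hpv : p ∣ padicValInt p m) :
    padicValNat p
        ((Subalgebra.toSubmodule (Algebra.adjoin ℤ {θ})).toAddSubgroup.index) >
      ((n - 1) * (padicValInt p m - 1) + Nat.gcd n (padicValInt p m) - 1) / 2 := by
  have hn0 : n ≠ 0 := by omega
  have hmonic : ((X : ℤ[X]) ^ n - C m).Monic := monic_X_pow_sub_C m hn0
  have hint : IsIntegral ℤ θ := NumberField.RingOfIntegers.isIntegral θ
  have hmin : minpoly ℤ θ = (X : ℤ[X]) ^ n - C m := by
    have hdvd := minpoly.isIntegrallyClosed_dvd hint hroot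
    have hass := (minpoly.irreducible hint).associated_of_dvd hirr hdvd
    exact eq_of_monic_of_associated (minpoly.monic hint) hmonic hass
  have hdeg : (minpoly ℤ θ).natDegree = n := by rw [hmin, natDegree_X_pow_sub_C]
  have hintQ : IsIntegral ℚ (θ : K) := Algebra.IsIntegral.isIntegral _
  have hrank : Module.finrank ℤ (NumberField.RingOfIntegers K) = n := by
    rw [NumberField.RingOfIntegers.rank,
      (PowerBasis.ofAdjoinEqTop' hintQ hgen).finrank, PowerBasis.ofAdjoinEqTop'_dim]
    have h1 : minpoly ℚ (θ : K) = (minpoly ℤ θ).map (algebraMap ℤ ℚ) := by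
      have h2 : minpoly ℤ (θ : K) = minpoly ℤ θ :=
        minpoly.algebraMap_eq (NumberField.RingOfIntegers.coe_injective) θ
      rw [← h2]
      exact minpoly.isIntegrallyClosed_eq_field_fractions' ℚ
        (NumberField.RingOfIntegers.isIntegral_coe θ)
    rw [h1, (minpoly.monic hint).natDegree_map, hdeg]
  have hθn : θ ^ n = (m : NumberField.RingOfIntegers K) := by
    simpa [sub_eq_zero] using hroot
  obtain ⟨m', hm'⟩ : (p : ℤ) ^ padicValInt p m ∣ m := padicValInt_dvd m
  have hfl := floor_sum n (padicValInt p m) hn hv1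
  generalize padicValInt p m = v at *
  refine lt_of_le_of_lt hfl ?_
  obtain ⟨n', rfl⟩ := hpn
  obtain ⟨v', rfl⟩ := hpv
  have hppos := hp.pos
  have hvnlt : v' < n' := lt_of_mul_lt_mul_left hvn (Nat.zero_le _)
  have hvpos : 0 < v' := Nat.pos_of_ne_zero (by rintro rfl; simp at hv1)
  have hθ : θ ^ (p * n') = (p : NumberField.RingOfIntegers K) ^ (p * v') * (m' : _) := by
    rw [hθn, hm']; push_cast; rfl
  obtain ⟨j, hjdef⟩ : ∃ j, j = (n' - 1) / v' := ⟨_, rfl⟩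
  have hj1 : 1 ≤ j := by rw [hjdef, Nat.one_le_div_iff hvpos]; omega
  have hjlt : j * v' < n' := by
    have := Nat.div_mul_le_self (n' - 1) v'
    rw [← hjdef] at this; omega
  have hjge : n' ≤ 2 * (j * v') := by
    have h1 := Nat.lt_mul_div_succ (n' - 1) hvpos
    rw [← hjdef, mul_add, mul_one, mul_comm] at h1
    have h2 := Nat.mul_le_mul_right v' hj1
    omega
  have hjn : j < n' := lt_of_le_of_lt (Nat.le_mul_of_pos_right j hvpos) hjlt
  have hJlt : j + (p - 1) * n' < p * n' := by
    have : p * n' = (p - 1) * n' + n' := by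
      rw [← Nat.succ_mul]; congr 1; omega
    omega
  let J : Fin (p * n') := ⟨j + (p - 1) * n', hJlt⟩
  let g0 : ℤ[X] := X ^ j * (X ^ n' - C (m' * (p : ℤ) ^ v')) ^ (p - 1)
  have hnpos : n' ≠ 0 := by omega
  have hg0m : g0.Monic := (monic_X_pow j).mul ((monic_X_pow_sub_C _ hnpos).pow _)
  have hg0d : g0.natDegree = j + (p - 1) * n' := by
    rw [(monic_X_pow j).natDegree_mul ((monic_X_pow_sub_C _ hnpos).pow _),
      (monic_X_pow_sub_C _ hnpos).natDegree_pow, natDegree_X_pow, natDegree_X_pow_sub_C]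
  have hmain := index_lower (p * n') θ hdeg hrank p hp
    (fun i => if i = J then g0 else X ^ (i : ℕ))
    (fun i => by split_ifs; exacts [hg0m, monic_X_pow _])
    (fun i => by
      split_ifs with h
      · rw [hg0d, h]
      · exact natDegree_X_pow _)
    (fun i => (i : ℕ) * (p * v') / (p * n') + if i = J then 1 else 0)
    (fun i => by
      split_ifs with h
      · have hfloor : (i : ℕ) * (p * v') / (p * n') = (p - 1) * v' := by
          rw [mul_left_comm, Nat.mul_div_mul_left _ _ hppos, h]
          change (j + (p - 1) * n') * v' / n' = _
          rw [show (j + (p - 1) * n') * v' = j * v' + n' * ((p - 1) * v') by ring,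
            Nat.add_mul_div_left _ _ (by omega), Nat.div_eq_of_lt hjlt, zero_add]
        rw [hfloor]
        have := extra_dvd θ p n' v' j m' hp (by omega) hθ hjge
        simpa [g0] using this
      · rw [add_zero, map_pow, aeval_X, ← IsIntegrallyClosed.pow_dvd_pow_iff hn0, ← pow_mul,
          ← pow_mul, mul_comm (i : ℕ) (p * n'), pow_mul θ, hθ, mul_pow, ← pow_mul]
        apply Dvd.dvd.mul_right
        apply pow_dvd_pow
        rw [mul_comm (p * v')]
        exact Nat.div_mul_le_self _ _)
  rw [Finset.sum_add_distrib, Finset.sum_ite_eq' Finset.univ J, if_pos (Finset.mem_univ _),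
    Fin.sum_univ_eq_sum_range (fun i => i * (p * v') / (p * n'))] at hmain
  omega
end

section
/- Let f(x) = x^n − m ∈ ℤ[x] be a monic irreducible polynomial with n ≥ 2, let p be an odd prime, write n = p^r · t with p not dividing t, and let K = ℚ(α) for a complex root α of f. If r ≥ p and ν_p(1 − m) ≥ p + 1, then p divides the index (𝓞_K : ℤ[θ]) for every θ ∈ 𝓞_K generating K over ℚ; in particular K is not monogenic. -/
open Polynomial

lemma nm_index {O : Type*} [CommRing O] (p : ℕ) [Fact p.Prime]
    (ψ : Fin (p+1) → (O →+* ZMod p)) (hψ : Function.Injective ψ) (θ : O) :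
    p ∣ (Subalgebra.toSubmodule (Algebra.adjoin ℤ {θ})).toAddSubgroup.index := by
  by_contra hnd
  set N := (Subalgebra.toSubmodule (Algebra.adjoin ℤ {θ})).toAddSubgroup.index with hN
  have hinj : Function.Injective (fun i => ψ i θ) := by
    intro i j hij
    apply hψ
    have hag : ∀ x ∈ Algebra.adjoin ℤ {θ}, ψ i x = ψ j x := by
      intro x hx
      induction hx using Algebra.adjoin_induction with
      | mem x hx => rw [Set.mem_singleton_iff] at hx; subst hx; exact hij
      | algebraMap r => simp
      | add x y _ _ h1 h2 => simp [h1, h2]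
      | mul x y _ _ h1 h2 => simp [h1, h2]
    ext x
    have hmem := (Subalgebra.toSubmodule (Algebra.adjoin ℤ {θ})).toAddSubgroup.nsmul_index_mem x
    have h := hag _ hmem
    rw [← hN] at h
    simp only [nsmul_eq_mul, map_mul, map_natCast] at h
    refine mul_left_cancel₀ ?_ h
    rwa [Ne, ZMod.natCast_eq_zero_iff]
  have := Fintype.card_le_of_injective _ hinj
  simp [ZMod.card] at this

lemma nm_total {O : Type*} [CommRing O] [IsDedekindDomain O] (P : Ideal O) [P.IsPrime] (hP : P ≠ ⊥)
    (x y : O) : ∃ d w, d ∉ P ∧ (d * x = y * w ∨ d * y = x * w) := by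
  have hdvr := IsLocalization.AtPrime.isDiscreteValuationRing_of_dedekind_domain O hP
    (Localization.AtPrime P)
  have key : ∀ x y : O, algebraMap O (Localization.AtPrime P) y ∣ algebraMap O _ x →
      ∃ d w, d ∉ P ∧ d * x = y * w := by
    rintro x y ⟨q, hq⟩
    obtain ⟨⟨a, s⟩, hs⟩ := IsLocalization.surj P.primeCompl q
    simp only at hs
    have : algebraMap O (Localization.AtPrime P) (s * x) = algebraMap O _ (y * a) := by
      rw [map_mul, map_mul, hq, ← hs]; ring
    obtain ⟨c, hc⟩ := (IsLocalization.eq_iff_exists P.primeCompl _).1 this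
    refine ⟨c * s, c * a, fun h => (c * s).2 h, ?_⟩
    linear_combination hc
  rcases ValuationRing.dvd_total (algebraMap O (Localization.AtPrime P) y) (algebraMap O _ x) with h | h
  · obtain ⟨d, w, h1, h2⟩ := key x y h
    exact ⟨d, w, h1, Or.inl h2⟩
  · obtain ⟨d, w, h1, h2⟩ := key y x h
    exact ⟨d, w, h1, Or.inr h2⟩

lemma nm_distinct {O : Type*} [CommRing O] [IsDedekindDomain O] (p : ℕ) [Fact p.Prime]
    {R S : Type*} [CommRing R] [IsDomain R] [CommRing S] [IsDomain S]
    (Φ : O →+* R) (ε : R →+* ZMod p) (Φ' : O →+* S) (ε' : S →+* ZMod p)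
    (hR : (p : R) ≠ 0) (hS : (p : S) ≠ 0) (a : O) (D D' : ℕ) (hD : D < D')
    (u : R) (hu : Φ a ^ D = p * u)
    (v : S) (hv : Φ' a ^ D' = p * v) (hv0 : ε' v ≠ 0) (ha : ε' (Φ' a) = 0) :
    ε.comp Φ ≠ ε'.comp Φ' := by
  intro heq
  have hO : (p : O) ≠ 0 := fun h => hR (by rw [← map_natCast Φ, h, map_zero])
  set P := RingHom.ker (ε.comp Φ) with hPdef
  have hPp : P.IsPrime := RingHom.ker_isPrime _
  have hpP : (p : O) ∈ P := by simp [hPdef, RingHom.mem_ker]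
  have hP : P ≠ ⊥ := by
    intro h; rw [h] at hpP; exact hO (by simpa using hpP)
  have e1 : ∀ z : O, z ∈ P ↔ ε (Φ z) = 0 := fun z => Iff.rfl
  have e2 : ∀ z : O, z ∈ P ↔ ε' (Φ' z) = 0 := fun z => by rw [hPdef, heq]; rfl
  have hv1 : v ≠ 0 := by rintro rfl; simp at hv0
  have hx0 : Φ' a ^ D ≠ 0 := by
    intro h
    have : Φ' a ^ D' = 0 := by
      rw [← Nat.sub_add_cancel hD.le, pow_add, h, mul_zero]
    rw [hv] at this
    exact mul_ne_zero hS hv1 this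
  have hs : Φ' a ^ D' = Φ' a ^ D * Φ' a ^ (D' - D) := by
    rw [← pow_add, Nat.add_sub_cancel' hD.le]
  have hs0 : ε' (Φ' a ^ (D' - D)) = 0 := by
    rw [map_pow, ha, zero_pow (by omega)]
  obtain ⟨d, w, hd, h | h⟩ := nm_total P hP (a ^ D) (p : O)
  · have h' := congrArg Φ' h
    simp only [map_mul, map_pow, map_natCast] at h'
    have : Φ' d * v = Φ' a ^ (D' - D) * Φ' w := by
      apply mul_left_cancel₀ hx0
      linear_combination v * h' - Φ' w * hv + Φ' w * hs
    have := congrArg ε' this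
    rw [map_mul, map_mul, hs0, zero_mul] at this
    exact hd ((e2 d).2 ((mul_eq_zero.1 this).resolve_right hv0))
  · have h' := congrArg Φ' h
    simp only [map_mul, map_pow, map_natCast] at h'
    have : Φ' d * Φ' a ^ (D' - D) = v * Φ' w := by
      apply mul_left_cancel₀ hx0
      linear_combination v * h' + Φ' d * hv - Φ' d * hs
    have := congrArg ε' this
    rw [map_mul, map_mul, hs0, mul_zero] at this
    have hw := (e2 w).2 ((mul_eq_zero.1 this.symm).resolve_left hv0)
    have h2 := congrArg Φ h
    simp only [map_mul, map_pow, map_natCast] at h2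
    have : Φ d = u * Φ w := by
      apply mul_left_cancel₀ hR
      linear_combination h2 + Φ w * hu
    have := congrArg ε this
    rw [map_mul, (e1 w).1 hw, mul_zero] at this
    exact hd ((e1 d).2 this)

lemma nm_toZMod (p : ℕ) [Fact p.Prime] (c : ℤ_[p]) : PadicInt.toZMod c = 0 ↔ (p : ℤ_[p]) ∣ c := by
  rw [← RingHom.mem_ker, PadicInt.ker_toZMod, PadicInt.maximalIdeal_eq_span_p,
    Ideal.mem_span_singleton]

lemma nm_not_dvd (p : ℕ) [Fact p.Prime] (c : ℤ_[p]) (h : (p : ℤ_[p]) ∣ c - 1) :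
    ¬ (p : ℤ_[p]) ∣ c := by
  intro h2
  have := dvd_sub h2 h
  rw [sub_sub_cancel] at this
  exact PadicInt.prime_p.not_isUnit (isUnit_of_dvd_one this)

lemma nm_root_t (p t : ℕ) [Fact p.Prime] (hpt : ¬ p ∣ t) (m : ℤ_[p]) (k : ℕ)
    (hm : (p : ℤ_[p]) ^ (k+1) ∣ m - 1) : ∃ c : ℤ_[p], c ^ t = m ∧ (p : ℤ_[p]) ^ (k+1) ∣ c - 1 := by
  have hpm : (p : ℤ_[p]) ∣ m - 1 := (dvd_pow_self _ (by omega)).trans hm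
  have ht : ‖(t : ℤ_[p])‖ = 1 := by
    have h1 : ¬ ‖((t : ℤ) : ℤ_[p])‖ < 1 := by
      rw [PadicInt.norm_int_lt_one_iff_dvd]; exact_mod_cast hpt
    exact le_antisymm (PadicInt.norm_le_one _) (not_lt.1 (by rwa [Int.cast_natCast] at h1))
  obtain ⟨c, hc, hc1, -⟩ := hensels_lemma (p := p) (F := (X ^ t - C m : ℤ_[p][X])) (a := 1) (by
    simp only [map_sub, map_pow, aeval_X, one_pow, aeval_C, derivative_X_pow,
      derivative_C, map_mul, sub_zero, mul_one, Algebra.algebraMap_self, RingHom.id_apply, map_natCast]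
    rw [ht, one_pow, ← norm_neg, neg_sub, PadicInt.norm_lt_one_iff_dvd]
    exact hpm)
  simp only [map_sub, map_pow, aeval_X, one_pow, aeval_C, derivative_X_pow,
      derivative_C, map_mul, sub_zero, mul_one, Algebra.algebraMap_self, RingHom.id_apply, map_natCast, ht] at hc hc1
  rw [PadicInt.norm_lt_one_iff_dvd] at hc1
  have hct := sub_eq_zero.1 hc
  refine ⟨c, hct, ?_⟩
  have h := emultiplicity_pow_sub_pow_of_prime PadicInt.prime_p hc1 (nm_not_dvd p c hc1) (n := t) (by
    rw [← PadicInt.norm_lt_one_iff_dvd, ht]; exact lt_irrefl _)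
  rw [one_pow, hct] at h
  rw [pow_dvd_iff_le_emultiplicity] at hm ⊢
  rwa [← h]

lemma nm_root_p (p : ℕ) [Fact p.Prime] (hodd : Odd p) (c : ℤ_[p]) (k : ℕ)
    (hc : (p : ℤ_[p]) ^ (k+2) ∣ c - 1) : ∃ b : ℤ_[p], b ^ p = c ∧ (p : ℤ_[p]) ^ (k+1) ∣ b - 1 := by
  have hp2 : 2 ≤ p := (Fact.out : p.Prime).two_le
  have hp3 : 3 ≤ p := by
    rcases hodd with ⟨q, hq⟩; omega
  obtain ⟨γ, hγ⟩ : (p : ℤ_[p]) ^ 2 ∣ c - 1 := (pow_dvd_pow _ (by omega)).trans hc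
  set a : ℤ_[p] := 1 + p * γ with ha
  have hp1 : (p : ℤ_[p]) ∣ a - 1 := ⟨γ, by rw [ha]; ring⟩
  have hna : ‖a‖ = 1 := by
    refine le_antisymm (PadicInt.norm_le_one _) (not_lt.1 ?_)
    rw [PadicInt.norm_lt_one_iff_dvd]; exact nm_not_dvd p a hp1
  have hF : (p : ℤ_[p]) ^ 3 ∣ a ^ p - c := by
    have e : a ^ p = ∑ j ∈ Finset.range (p+1), (p * γ) ^ j * (p.choose j : ℤ_[p]) := by
      rw [ha, add_comm, add_pow]; simp
    have hsum : a ^ p - c = ∑ j ∈ Finset.range (p - 1), (p * γ) ^ (j+2) * (p.choose (j+2) : ℤ_[p]) := by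
      rw [e, show p + 1 = (p - 1) + 1 + 1 by omega, Finset.sum_range_succ', Finset.sum_range_succ']
      simp only [pow_zero, Nat.choose_zero_right, zero_add, Nat.choose_one_right, pow_one]
      push_cast
      linear_combination -hγ
    rw [hsum]
    apply Finset.dvd_sum
    intro j hj
    rw [Finset.mem_range] at hj
    rcases Nat.eq_zero_or_pos j with rfl | hj0
    · obtain ⟨q, hq⟩ := (Fact.out : p.Prime).dvd_choose_self (k := 2) (by omega) (by omega)
      simp only [zero_add]
      rw [hq]; push_cast
      exact ⟨γ^2 * q, by ring⟩
    · rw [mul_pow]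
      exact ((pow_dvd_pow _ (by omega)).mul_right _).mul_right _
  obtain ⟨b, hb, hb1, -⟩ := hensels_lemma (p := p) (F := (X ^ p - C c : ℤ_[p][X])) (a := a) (by
    simp only [map_sub, map_pow, aeval_X, aeval_C, derivative_X_pow,
      derivative_C, map_mul, sub_zero, Algebra.algebraMap_self, RingHom.id_apply, map_natCast]
    rw [norm_mul, norm_pow, hna, one_pow, mul_one, PadicInt.norm_p]
    have := (PadicInt.norm_le_pow_iff_mem_span_pow (a ^ p - c) 3).2 (Ideal.mem_span_singleton.2 hF)
    refine this.trans_lt ?_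
    have h1 : (1:ℝ) < p := by exact_mod_cast (by omega : 1 < p)
    rw [← zpow_neg_one, ← zpow_natCast, ← zpow_mul]
    exact zpow_lt_zpow_right₀ h1 (by norm_num))
  simp only [map_sub, map_pow, aeval_X, aeval_C, derivative_X_pow,
      derivative_C, map_mul, sub_zero, Algebra.algebraMap_self, RingHom.id_apply, map_natCast] at hb hb1
  have hbp := sub_eq_zero.1 hb
  have hba : (p : ℤ_[p]) ∣ b - a := by
    rw [← PadicInt.norm_lt_one_iff_dvd]
    refine hb1.trans_le ?_
    exact PadicInt.norm_le_one _
  have hb2 : (p : ℤ_[p]) ∣ b - 1 := by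
    have := dvd_add hba hp1
    rwa [sub_add_sub_cancel] at this
  refine ⟨b, hbp, ?_⟩
  have h := emultiplicity_pow_prime_sub_pow_prime PadicInt.prime_p hodd hb2 (nm_not_dvd p b hb2)
  rw [one_pow, hbp] at h
  rw [pow_dvd_iff_le_emultiplicity] at hc ⊢
  rw [h] at hc
  have : ((k + 1 : ℕ) : ℕ∞) + 1 ≤ emultiplicity (p : ℤ_[p]) (b - 1) + 1 := by
    convert hc using 1
    push_cast
    ring
  exact (ENat.add_le_add_iff_right (by simp)).1 this

lemma nm_root_pp (p : ℕ) [Fact p.Prime] (hodd : Odd p) (k : ℕ) : ∀ (c : ℤ_[p])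
    (_ : (p : ℤ_[p]) ^ (k+1) ∣ c - 1), ∃ b : ℤ_[p], b ^ (p ^ k) = c ∧ (p : ℤ_[p]) ∣ b - 1 := by
  induction k with
  | zero => intro c hc; exact ⟨c, by simp, by simpa using hc⟩
  | succ k ih =>
    intro c hc
    obtain ⟨b, hb, hb1⟩ := nm_root_p p hodd c k hc
    obtain ⟨b', hb', hb1'⟩ := ih b hb1
    exact ⟨b', by rw [pow_succ, pow_mul, hb', hb], hb1'⟩

lemma nm_toZMod_one (p : ℕ) [Fact p.Prime] (c : ℤ_[p]) (h : (p : ℤ_[p]) ∣ c - 1) :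
    PadicInt.toZMod c = 1 := by
  rw [← sub_eq_zero, ← map_one PadicInt.toZMod, ← map_sub, nm_toZMod]; exact h

lemma nm_E2 (p : ℕ) [Fact p.Prime] (a : ℕ) (b : ℤ_[p]) (hb : (p : ℤ_[p]) ∣ b - 1) :
    ((1 + X : ℤ_[p][X]) ^ (p ^ a) - C b).Monic ∧
    ((1 + X : ℤ_[p][X]) ^ (p ^ a) - C b).natDegree = p ^ a ∧
    ((1 + X : ℤ_[p][X]) ^ (p ^ a) - C b).map PadicInt.toZMod = X ^ (p ^ a) ∧
    ((1 + X : ℤ_[p][X]) ^ (p ^ a) - C b).coeff 0 = 1 - b := by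
  have hN : 0 < p ^ a := pow_pos (Fact.out : p.Prime).pos a
  have hm : (1 + X : ℤ_[p][X]).Monic := by rw [add_comm]; exact monic_X_add_C 1
  have hd1 : (1 + X : ℤ_[p][X]).natDegree = 1 := by rw [add_comm]; exact natDegree_X_add_C 1
  have hd : ((1 + X : ℤ_[p][X]) ^ (p ^ a)).natDegree = p ^ a := by
    rw [hm.natDegree_pow, hd1, mul_one]
  refine ⟨?_, ?_, ?_, ?_⟩
  · apply (hm.pow _).sub_of_left
    rw [degree_eq_natDegree (hm.pow _).ne_zero, hd]
    exact degree_C_le.trans_lt (by exact_mod_cast hN)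
  · rw [natDegree_sub_C, hd]
  · have := nm_toZMod_one p b hb
    simp only [Polynomial.map_sub, Polynomial.map_pow, Polynomial.map_add, Polynomial.map_one, map_X,
      map_C, this]
    rw [add_pow_char_pow]; simp
  · rw [coeff_zero_eq_eval_zero]; simp

lemma nm_E1 (p : ℕ) [Fact p.Prime] (hodd : Odd p) (a : ℕ) (B : ℤ_[p]) (hB : (p : ℤ_[p]) ∣ B - 1) :
    ∃ g : ℤ_[p][X], g.Monic ∧ g.natDegree = p ^ a * (p - 1) ∧
      g.map PadicInt.toZMod = X ^ (p ^ a * (p - 1)) ∧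
      ¬ (p : ℤ_[p]) ^ 2 ∣ g.coeff 0 ∧
      g * ((1 + X) ^ (p ^ a) - C B) = (1 + X) ^ (p ^ (a + 1)) - C (B ^ p) := by
  have hp : p.Prime := Fact.out
  have hBp : (p : ℤ_[p]) ∣ B ^ p - 1 := by
    have := sub_dvd_pow_sub_pow B 1 p
    rw [one_pow] at this
    exact hB.trans this
  obtain ⟨m1, d1, z1, -⟩ := nm_E2 p a B hB
  obtain ⟨m2, d2, z2, -⟩ := nm_E2 p (a+1) (B ^ p) hBp
  set h1 := ((1 + X : ℤ_[p][X]) ^ (p ^ a) - C B) with hh1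
  set h2 := ((1 + X : ℤ_[p][X]) ^ (p ^ (a+1)) - C (B ^ p)) with hh2
  set g : ℤ_[p][X] := ∑ i ∈ Finset.range p, ((1 + X : ℤ_[p][X]) ^ (p ^ a)) ^ i * (C B) ^ (p - 1 - i) with hg
  have hmul : g * h1 = h2 := by
    rw [hg, hh1, hh2, geom_sum₂_mul, pow_succ p, pow_mul, C_pow]
  have hgm : g.Monic := m1.of_mul_monic_right (by rw [hmul]; exact m2)
  have e : p ^ (a+1) = p ^ a * (p - 1) + p ^ a := by
    rw [pow_succ, ← Nat.mul_add_one, Nat.sub_add_cancel hp.one_le]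
  refine ⟨g, hgm, ?_, ?_, ?_, hmul⟩
  · have := hgm.natDegree_mul m1
    rw [hmul, d1, d2] at this
    omega
  · have := congrArg (Polynomial.map PadicInt.toZMod) hmul
    rw [Polynomial.map_mul, z1, z2, e, pow_add] at this
    exact mul_right_cancel₀ (pow_ne_zero _ X_ne_zero) this
  · have h0 : g.coeff 0 = ∑ i ∈ Finset.range p, 1 ^ i * B ^ (p - 1 - i) := by
      rw [coeff_zero_eq_eval_zero, hg, eval_finsetSum]; simp
    have hB' : (p : ℤ_[p]) ∣ 1 - B := by rw [← neg_sub]; exact hB.neg_right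
    have := emultiplicity_geom_sum₂_eq_one PadicInt.prime_p hodd hB'
      (fun h => PadicInt.prime_p.not_isUnit (isUnit_of_dvd_one h))
    rw [h0, pow_dvd_iff_le_emultiplicity, this]
    norm_num

lemma nm_ring (p : ℕ) [Fact p.Prime] {K : Type*} [Field K] [NumberField K] (n : ℕ) (m : ℤ) (hn : 2 ≤ n)
    (hirr : Irreducible ((X : ℤ[X]) ^ n - C m))
    (α : NumberField.RingOfIntegers K) (hroot : (α : K) ^ n = m)
    (hgen : Algebra.adjoin ℚ {(α : K)} = ⊤)
    (g : ℤ_[p][X]) (hg : g.Monic) (D : ℕ) (hD : 0 < D) (hgD : g.natDegree = D)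
    (hmap : g.map PadicInt.toZMod = X ^ D) (h0 : ¬ (p : ℤ_[p]) ^ 2 ∣ g.coeff 0) :
    ∃ (R : Type) (_ : CommRing R) (_ : IsDomain R) (_ : Algebra ℤ_[p] R) (π : R) (ε : R →+* ZMod p),
      aeval π g = 0 ∧ (∀ c, ε (algebraMap _ _ c) = PadicInt.toZMod c) ∧ ε π = 0 ∧ (p : R) ≠ 0 ∧
      ∀ y : R, y ^ n = m → ∃ Φ : NumberField.RingOfIntegers K →+* R, Φ α = y := by
  have hpp : Prime (p : ℤ_[p]) := PadicInt.prime_p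
  have hei : g.IsEisensteinAt (Ideal.span {(p : ℤ_[p])}) := by
    refine ⟨?_, ?_, ?_⟩
    · rw [hg.leadingCoeff, Ideal.mem_span_singleton]
      exact fun h => hpp.not_isUnit (isUnit_of_dvd_one h)
    · intro i hi
      have := congrArg (fun f => f.coeff i) hmap
      simp only [coeff_map, coeff_X_pow] at this
      rw [if_neg (by omega), nm_toZMod] at this
      rwa [Ideal.mem_span_singleton]
    · rwa [Ideal.span_singleton_pow, Ideal.mem_span_singleton]
  have hgirr : Irreducible g := hei.irreducible
    ((Ideal.span_singleton_prime hpp.ne_zero).2 hpp) hg.isPrimitive (by omega)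
  have hgirr' : Irreducible (g.map (algebraMap ℤ_[p] ℚ_[p])) :=
    (hg.irreducible_iff_irreducible_map_fraction_map).1 hgirr
  have := Fact.mk hgirr'
  let L := AdjoinRoot (g.map (algebraMap ℤ_[p] ℚ_[p]))
  let pb : PowerBasis ℚ_[p] L := AdjoinRoot.powerBasis hgirr'.ne_zero
  have hpb : pb.gen = AdjoinRoot.root (g.map (algebraMap ℤ_[p] ℚ_[p])) := rfl
  have : IsScalarTower ℤ_[p] ℚ_[p] L := inferInstance
  have hpi : aeval pb.gen g = 0 := by
    rw [← aeval_map_algebraMap ℚ_[p], hpb, aeval_def, AdjoinRoot.algebraMap_eq, AdjoinRoot.eval₂_root]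
  have hinjL : Function.Injective (algebraMap ℤ_[p] L) := by
    rw [IsScalarTower.algebraMap_eq ℤ_[p] ℚ_[p] L]
    exact (algebraMap ℚ_[p] L).injective.comp (IsFractionRing.injective _ _)
  have htf : Module.IsTorsionFree ℤ_[p] L := Module.isTorsionFree_iff_algebraMap_injective.mpr hinjL
  have hint : IsIntegral ℤ_[p] pb.gen := ⟨g, hg, hpi⟩
  have hmin : minpoly ℤ_[p] pb.gen = g := by
    have hinj : Function.Injective (algebraMap ℤ_[p] ℚ_[p]) := IsFractionRing.injective _ _
    apply Polynomial.map_injective _ hinj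
    rw [← minpoly.isIntegrallyClosed_eq_field_fractions' ℚ_[p] hint]
    symm
    apply minpoly.eq_of_irreducible_of_monic hgirr' _ (hg.map _)
    rw [aeval_map_algebraMap, hpi]
  have hmem : ∀ z : L, IsIntegral ℤ_[p] z → z ∈ Algebra.adjoin ℤ_[p] ({pb.gen} : Set L) := by
    intro z hz
    have hz' : ∃ k : ℕ, (p : ℤ_[p]) ^ k • z ∈ Algebra.adjoin ℤ_[p] ({pb.gen} : Set L) := by
      have hztop : z ∈ Algebra.adjoin ℚ_[p] ({pb.gen} : Set L) := by
        rw [pb.adjoin_gen_eq_top]; trivial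
      rw [Algebra.adjoin_singleton_eq_range_aeval] at hztop
      obtain ⟨f, hf⟩ := hztop
      obtain ⟨b, hb, hbf⟩ := IsLocalization.integerNormalization_spec (nonZeroDivisors ℤ_[p]) f
      have hb0 : b ≠ 0 := nonZeroDivisors.ne_zero hb
      refine ⟨b.valuation, ?_⟩
      have h1 : b • z ∈ Algebra.adjoin ℤ_[p] ({pb.gen} : Set L) := by
        have h2 : b • z = aeval pb.gen
            (IsLocalization.integerNormalization (nonZeroDivisors ℤ_[p]) f) := by
          rw [← aeval_map_algebraMap ℚ_[p], hbf, ← IsScalarTower.algebraMap_smul ℚ_[p] b f, map_smul,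
            IsScalarTower.algebraMap_smul, ← hf]
          rfl
        rw [h2]
        exact aeval_mem_adjoin_singleton _ _
      have h3 : (p : ℤ_[p]) ^ b.valuation =
          ((PadicInt.unitCoeff hb0)⁻¹ : ℤ_[p]ˣ) * b := by
        rw [Units.eq_inv_mul_iff_mul_eq, ← PadicInt.unitCoeff_spec hb0]
      rw [h3, mul_smul]
      exact Subalgebra.smul_mem _ h1 _
    obtain ⟨k, hk⟩ := hz'
    exact mem_adjoin_of_smul_prime_pow_smul_of_minpoly_isEisensteinAt hpp hint hz hk (by rwa [hmin])
  let R := Algebra.adjoin ℤ_[p] ({pb.gen} : Set L)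
  let π : R := ⟨pb.gen, Algebra.self_mem_adjoin_singleton _ _⟩
  let E := minpoly.equivAdjoin hint
  have hεg : eval₂ (PadicInt.toZMod : ℤ_[p] →+* ZMod p) 0 (minpoly ℤ_[p] pb.gen) = 0 := by
    rw [hmin, ← eval_map, hmap]; simp [hD.ne']
  let ε₀ : AdjoinRoot (minpoly ℤ_[p] pb.gen) →+* ZMod p := AdjoinRoot.lift PadicInt.toZMod 0 hεg
  let ε : R →+* ZMod p := ε₀.comp (E.symm : R →+* AdjoinRoot (minpoly ℤ_[p] pb.gen))
  have hcz : CharZero L := charZero_of_injective_algebraMap (algebraMap ℚ_[p] L).injective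
  refine ⟨R, inferInstance, inferInstance, inferInstance, π, ε, ?_, ?_, ?_, ?_, ?_⟩
  · apply Subtype.ext
    have := aeval_algHom_apply R.val π g
    rw [← Subalgebra.coe_val, ← this]
    exact hpi
  · intro c
    have : E.symm (algebraMap ℤ_[p] R c) = algebraMap _ _ c := E.symm.commutes c
    change ε₀ (E.symm (algebraMap ℤ_[p] R c)) = _
    rw [this, AdjoinRoot.algebraMap_eq, AdjoinRoot.lift_of]
  · have : E (AdjoinRoot.root _) = π := by
      apply Subtype.ext
      exact AdjoinRoot.Minpoly.coe_toAdjoin_mk_X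
    change ε₀ (E.symm π) = _
    rw [← this, AlgEquiv.symm_apply_apply, AdjoinRoot.lift_root]
  · intro h
    have := congrArg R.val h
    simp only [map_natCast, map_zero] at this
    exact (Fact.out : p.Prime).ne_zero (by exact_mod_cast this)
  · intro y hy
    have hmon : ((X : ℤ[X]) ^ n - C m).Monic := monic_X_pow_sub_C m (by omega)
    have hQirr : Irreducible ((X : ℚ[X]) ^ n - C (m : ℚ)) := by
      have := (hmon.irreducible_iff_irreducible_map_fraction_map (K := ℚ)).1 hirr
      simpa using this
    have hminα : minpoly ℚ (α : K) = X ^ n - C (m : ℚ) := by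
      symm
      apply minpoly.eq_of_irreducible_of_monic hQirr _ (monic_X_pow_sub_C _ (by omega))
      simp [hroot]
    have hαint : IsIntegral ℚ (α : K) := Algebra.IsIntegral.isIntegral _
    let pk := PowerBasis.ofAdjoinEqTop hαint hgen
    let φ : K →ₐ[ℚ] L := pk.lift (y : L) (by
      rw [PowerBasis.ofAdjoinEqTop_gen, hminα]
      have := congrArg R.val hy
      simp only [map_pow, map_intCast] at this
      simp only [map_sub, map_pow, aeval_X, aeval_C]
      rw [eq_ratCast]
      push_cast
      rw [sub_eq_zero]
      exact this)
    have hφ : φ (α : K) = y := pk.lift_gen _ _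
    have hφint : ∀ z : NumberField.RingOfIntegers K, φ (z : K) ∈ R := by
      intro z
      apply hmem
      have h1 : IsIntegral ℤ (z : K) := NumberField.RingOfIntegers.isIntegral_coe z
      have h2 : IsIntegral ℤ (φ (z : K)) := h1.map (φ.restrictScalars ℤ)
      exact h2.tower_top
    refine ⟨((φ : K →+* L).comp (algebraMap _ K)).codRestrict R hφint, ?_⟩
    apply Subtype.ext
    exact hφ

def NMWeak (p : ℕ) {O : Type*} [CommRing O] (a : O) (D : ℕ) (ψ : O →+* ZMod p) : Prop :=
  ∃ (R : Type) (_ : CommRing R) (_ : IsDomain R) (Φ : O →+* R) (ε : R →+* ZMod p),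
    ψ = ε.comp Φ ∧ (p : R) ≠ 0 ∧ ∃ v, Φ a ^ D = p * v

def NMStrong (p : ℕ) {O : Type*} [CommRing O] (a : O) (D : ℕ) (ψ : O →+* ZMod p) : Prop :=
  ∃ (R : Type) (_ : CommRing R) (_ : IsDomain R) (Φ : O →+* R) (ε : R →+* ZMod p),
    ψ = ε.comp Φ ∧ (p : R) ≠ 0 ∧ ∃ v, Φ a ^ D = p * v ∧ ε v ≠ 0 ∧ ε (Φ a) = 0

lemma NMStrong.weak {p : ℕ} {O : Type*} [CommRing O] {a : O} {D : ℕ} {ψ : O →+* ZMod p}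
    (h : NMStrong p a D ψ) : NMWeak p a D ψ := by
  obtain ⟨R, i1, i2, Φ, ε, h1, h2, v, h3, -⟩ := h
  exact ⟨R, i1, i2, Φ, ε, h1, h2, v, h3⟩

lemma nm_ne {O : Type*} [CommRing O] [IsDedekindDomain O] (p : ℕ) [Fact p.Prime] (a : O)
    (D D' : ℕ) (hD : D < D') (ψ ψ' : O →+* ZMod p) (h : NMWeak p a D ψ) (h' : NMStrong p a D' ψ') :
    ψ ≠ ψ' := by
  obtain ⟨R, i1, i2, Φ, ε, rfl, h2, v, h3⟩ := h
  obtain ⟨R', i1', i2', Φ', ε', rfl, h2', v', h3', h4', h5'⟩ := h'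
  exact nm_distinct p Φ ε Φ' ε' h2 h2' a D D' hD v h3 v' h3' h4' h5'

lemma nm_strong (p : ℕ) [Fact p.Prime] {K : Type*} [Field K] [NumberField K] (n : ℕ) (m : ℤ) (hn : 2 ≤ n)
    (hirr : Irreducible ((X : ℤ[X]) ^ n - C m))
    (α : NumberField.RingOfIntegers K) (hroot : (α : K) ^ n = m)
    (hgen : Algebra.adjoin ℚ {(α : K)} = ⊤)
    (g : ℤ_[p][X]) (hg : g.Monic) (D : ℕ) (hD : 0 < D) (hgD : g.natDegree = D)
    (hmap : g.map PadicInt.toZMod = X ^ D) (h0 : ¬ (p : ℤ_[p]) ^ 2 ∣ g.coeff 0)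
    (hdvd : g ∣ (1 + X) ^ n - C (m : ℤ_[p])) : ∃ ψ, NMStrong p (α - 1) D ψ := by
  obtain ⟨R, i1, i2, i3, π, ε, h1, h2, h3, h4, h5⟩ :=
    nm_ring p n m hn hirr α hroot hgen g hg D hD hgD hmap h0
  obtain ⟨Φ, hΦ⟩ := h5 (1 + π) (by
    obtain ⟨q, hq⟩ := hdvd
    have := congrArg (aeval π) hq
    rw [map_mul, h1, zero_mul] at this
    simp only [map_sub, map_pow, map_add, map_one, aeval_X, aeval_C, map_intCast] at this
    exact sub_eq_zero.1 this)
  have hπ : Φ (α - 1) = π := by rw [map_sub, hΦ, map_one]; ring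
  have hq : C (p : ℤ_[p]) ∣ X ^ D - g := by
    rw [C_dvd_iff_dvd_coeff]
    intro i
    rw [← nm_toZMod, ← coeff_map, Polynomial.map_sub, hmap]
    simp
  obtain ⟨q, hq⟩ := hq
  refine ⟨_, R, i1, i2, Φ, ε, rfl, h4, aeval π q, ?_, ?_, ?_⟩
  · have := congrArg (aeval π) hq
    simp only [map_sub, map_pow, aeval_X, h1, sub_zero, map_mul, aeval_C, map_natCast] at this
    rw [hπ, this]
  · have e1 : ε (aeval π q) = PadicInt.toZMod (q.coeff 0) := by
      rw [aeval_def, hom_eval₂, h3]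
      rw [eval₂_at_zero, RingHom.comp_apply, h2]
    rw [e1, Ne, nm_toZMod]
    rintro ⟨s, hs⟩
    apply h0
    have := congrArg (fun f => f.coeff 0) hq
    simp only [coeff_sub, coeff_X_pow, coeff_C_mul] at this
    rw [if_neg (by omega), hs] at this
    exact ⟨-s, by linear_combination -this⟩
  · rw [hπ, h3]

lemma nm_strong1 (p : ℕ) [Fact p.Prime] (hodd : Odd p) {K : Type*} [Field K] [NumberField K] (n : ℕ)
    (m : ℤ) (hn : 2 ≤ n)
    (hirr : Irreducible ((X : ℤ[X]) ^ n - C m))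
    (α : NumberField.RingOfIntegers K) (hroot : (α : K) ^ n = m)
    (hgen : Algebra.adjoin ℚ {(α : K)} = ⊤) (t a e : ℕ) (B : ℤ_[p]) (hB : (p : ℤ_[p]) ∣ B - 1)
    (hBm : (B ^ (p ^ (e + 1))) ^ t = m) (hnt : n = p ^ (a + e + 1) * t) :
    ∃ ψ, NMStrong p (α - 1) (p ^ a * (p - 1)) ψ := by
  have hp2 : 2 ≤ p := (Fact.out : p.Prime).two_le
  obtain ⟨g, hg, hd, hmap, h0, hmul⟩ := nm_E1 p hodd a B hB
  refine nm_strong p n m hn hirr α hroot hgen g hg _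
    (Nat.mul_pos (pow_pos (by omega) _) (by omega)) hd hmap h0 ?_
  refine (Dvd.intro _ hmul).trans ?_
  have h1 := sub_dvd_pow_sub_pow ((1 + X : ℤ_[p][X]) ^ (p ^ (a + 1))) (C (B ^ p)) (p ^ e * t)
  have e1 : p ^ (a + 1) * (p ^ e * t) = n := by rw [hnt]; ring
  have e2 : (B ^ p) ^ (p ^ e * t) = m := by rw [← hBm]; ring
  rwa [← pow_mul, e1, ← C_pow, e2] at h1

lemma nm_extra (p : ℕ) [Fact p.Prime] (hodd : Odd p) {K : Type*} [Field K] [NumberField K] (n : ℕ)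
    (m : ℤ) (hn : 2 ≤ n)
    (hirr : Irreducible ((X : ℤ[X]) ^ n - C m))
    (α : NumberField.RingOfIntegers K) (hroot : (α : K) ^ n = m)
    (hgen : Algebra.adjoin ℚ {(α : K)} = ⊤) (t a : ℕ) (b : ℤ_[p]) (hb : (p : ℤ_[p]) ∣ b - 1)
    (hbm : (b ^ (p ^ p)) ^ t = m) (hnt : n = p ^ (a + p) * t) :
    ∃ D ψ, D < p ^ a * (p - 1) ∧ NMWeak p (α - 1) D ψ := by
  have hp2 : 2 ≤ p := (Fact.out : p.Prime).two_le
  have hp3 : 3 ≤ p := by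
    rcases hodd with ⟨q, hq⟩; omega
  have hlt : p ^ a < p ^ a * (p - 1) := lt_mul_of_one_lt_right (pow_pos (by omega) _) (by omega)
  rcases Nat.eq_zero_or_pos a with rfl | ha
  · obtain ⟨R, i1, i2, i3, π, ε, h1, h2, h3, h4, h5⟩ :=
      nm_ring p n m hn hirr α hroot hgen (X - C (p : ℤ_[p])) (monic_X_sub_C _) 1 one_pos
        (natDegree_X_sub_C _) (by simp) (by
          rintro ⟨s, hs⟩
          simp only [coeff_sub, coeff_X_zero, coeff_C_zero] at hs
          have : (p : ℤ_[p]) * (p * (-s)) = p * 1 := by linear_combination hs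
          have := mul_left_cancel₀ PadicInt.prime_p.ne_zero this
          exact PadicInt.prime_p.not_isUnit (isUnit_of_dvd_one ⟨_, this.symm⟩))
    obtain ⟨Φ, hΦ⟩ := h5 (algebraMap _ _ b) (by
      rw [← map_pow, hnt, zero_add, pow_mul, hbm, map_intCast])
    obtain ⟨s, hs⟩ := hb
    refine ⟨1, ε.comp Φ, by simpa using hlt, R, i1, i2, Φ, ε, rfl, h4, algebraMap _ _ s, ?_⟩
    rw [pow_one, map_sub, hΦ, map_one, ← map_one (algebraMap ℤ_[p] R), ← map_sub, hs, map_mul, map_natCast]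
  · by_cases hb2 : (p : ℤ_[p]) ^ 2 ∣ b - 1
    · obtain ⟨b', hb', hb1'⟩ := nm_root_p p hodd b 0 (by simpa using hb2)
      obtain ⟨a, rfl⟩ : ∃ a', a = a' + 1 := ⟨a - 1, by omega⟩
      obtain ⟨ψ, hψ⟩ := nm_strong1 p hodd n m hn hirr α hroot hgen t a p b' (by simpa using hb1')
        (by rw [← hbm, ← hb']; ring) (by rw [hnt]; ring)
      refine ⟨_, ψ, ?_, hψ.weak⟩
      exact Nat.mul_lt_mul_of_pos_right (Nat.pow_lt_pow_right (by omega) (by omega)) (by omega)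
    · obtain ⟨m1, d1, z1, c1⟩ := nm_E2 p a b hb
      obtain ⟨ψ, hψ⟩ := nm_strong p n m hn hirr α hroot hgen _ m1 _ (pow_pos (by omega) _) d1 z1
        (by rw [c1, ← neg_sub, dvd_neg]; exact hb2) (by
          have h1 := sub_dvd_pow_sub_pow ((1 + X : ℤ_[p][X]) ^ (p ^ a)) (C b) (p ^ p * t)
          have e1 : p ^ a * (p ^ p * t) = n := by rw [hnt]; ring
          have e2 : b ^ (p ^ p * t) = m := by rw [← hbm]; ring
          rwa [← pow_mul, e1, ← C_pow, e2] at h1)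
      exact ⟨_, ψ, hlt, hψ.weak⟩

lemma nm_homs (p : ℕ) [Fact p.Prime] (hodd : Odd p) {K : Type*} [Field K] [NumberField K] (n : ℕ)
    (m : ℤ) (hn : 2 ≤ n)
    (hirr : Irreducible ((X : ℤ[X]) ^ n - C m))
    (α : NumberField.RingOfIntegers K) (hroot : (α : K) ^ n = m)
    (hgen : Algebra.adjoin ℚ {(α : K)} = ⊤) (t a : ℕ) (hpt : ¬ p ∣ t)
    (hnt : n = p ^ (a + p) * t) (hm : (p : ℤ) ^ (p + 1) ∣ m - 1) :
    ∃ ψ : Fin (p + 1) → (NumberField.RingOfIntegers K →+* ZMod p), Function.Injective ψ := by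
  have hp2 : 2 ≤ p := (Fact.out : p.Prime).two_le
  obtain ⟨c, hc, hc1⟩ := nm_root_t p t hpt (m : ℤ_[p]) p (by
    have := map_dvd (Int.castRingHom ℤ_[p]) hm
    simpa using this)
  have hs : ∀ i : Fin p, ∃ ψ, NMStrong p (α - 1) (p ^ (a + i) * (p - 1)) ψ := by
    intro i
    have hi := i.2
    obtain ⟨B, hB, hB1⟩ := nm_root_pp p hodd (p - 1 - i + 1) c
      ((pow_dvd_pow _ (by omega)).trans hc1)
    refine nm_strong1 p hodd n m hn hirr α hroot hgen t (a + i) (p - 1 - i) B hB1 (by rw [hB, hc]) ?_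
    rw [hnt]; congr 2; omega
  choose ψ hψ using hs
  obtain ⟨b, hb, hb1⟩ := nm_root_pp p hodd p c hc1
  obtain ⟨D, ψ', hD, hψ'⟩ := nm_extra p hodd n m hn hirr α hroot hgen t a b hb1 (by rw [hb, hc]) hnt
  have hlt : ∀ i j : Fin p, i < j → p ^ (a + i) * (p - 1) < p ^ (a + (j : ℕ)) * (p - 1) := by
    intro i j hij
    exact Nat.mul_lt_mul_of_pos_right (Nat.pow_lt_pow_right (by omega) (by
      have : (i : ℕ) < j := hij
      omega)) (by omega)
  refine ⟨Fin.cons ψ' ψ, ?_⟩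
  rw [Fin.cons_injective_iff]
  constructor
  · rintro ⟨i, hi⟩
    refine nm_ne p (α - 1) D _ ?_ ψ' (ψ i) hψ' (hψ i) hi.symm
    exact hD.trans_le (Nat.mul_le_mul_right _ (Nat.pow_le_pow_right (by omega) (by omega)))
  · intro i j hij
    by_contra hne
    rcases lt_or_gt_of_ne hne with h | h
    · exact nm_ne p (α - 1) _ _ (hlt i j h) _ _ (hψ i).weak (hψ j) hij
    · exact nm_ne p (α - 1) _ _ (hlt j i h) _ _ (hψ j).weak (hψ i) hij.symm

/-- Let `f(x) = x^n - m` be monic irreducible, `n ≥ 2`, `p` an odd prime, `n = p^r·t`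
with `p ∤ t`, and `K = ℚ(α)` for a root `α` of `f`. If `r ≥ p` and `ν_p(1-m) ≥ p+1`,
then `p` divides `(𝓞_K : ℤ[θ])` for every generator `θ ∈ 𝓞_K` of `K`; in particular
`K` is not monogenic. -/
theorem not_monogenic_case1
    {K : Type*} [Field K] [NumberField K] (n : ℕ) (m : ℤ) (hn : 2 ≤ n)
    (hirr : Irreducible ((X : ℤ[X]) ^ n - C m))
    (α : K) (hroot : Polynomial.aeval α ((X : ℤ[X]) ^ n - C m) = 0)
    (hgen : Algebra.adjoin ℚ {α} = ⊤)
    (p r t : ℕ) (hp : p.Prime) (hpodd : Odd p)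
    (hnrt : n = p ^ r * t) (hpt : ¬ p ∣ t)
    (hrp : r ≥ p) (hval : padicValInt p (1 - m) ≥ p + 1) :
    (∀ θ : NumberField.RingOfIntegers K, Algebra.adjoin ℚ {(θ : K)} = ⊤ →
        p ∣ (Subalgebra.toSubmodule (Algebra.adjoin ℤ {θ})).toAddSubgroup.index) ∧
      ¬ ∃ θ : NumberField.RingOfIntegers K, Algebra.adjoin ℤ {θ} = ⊤ := by
  have hfact : Fact p.Prime := ⟨hp⟩
  have hint : IsIntegral ℤ α := ⟨X ^ n - C m, monic_X_pow_sub_C m (by omega), hroot⟩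
  have hroot' : α ^ n = m := by
    simp only [map_sub, map_pow, aeval_X, eq_intCast, map_intCast] at hroot
    exact sub_eq_zero.1 hroot
  have hm : (p : ℤ) ^ (p + 1) ∣ m - 1 := by
    rw [← neg_sub, dvd_neg]
    exact (pow_dvd_pow _ hval).trans (padicValInt_dvd _)
  obtain ⟨ψ, hψ⟩ := nm_homs p hpodd n m hn hirr ⟨α, hint⟩ hroot' hgen t (r - p) hpt
    (by rw [hnrt, Nat.sub_add_cancel hrp]) hm
  refine ⟨fun θ _ => nm_index p ψ hψ θ, ?_⟩
  rintro ⟨θ, hθ⟩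
  have h := nm_index p ψ hψ θ
  rw [hθ] at h
  have : (Subalgebra.toSubmodule (⊤ : Subalgebra ℤ (NumberField.RingOfIntegers K))).toAddSubgroup.index = 1 := by
    rw [AddSubgroup.index_eq_one]
    ext x
    simp
  rw [this] at h
  exact hp.one_lt.ne' (Nat.dvd_one.1 h)
end

section
/- Let f(x) = x^n − m ∈ ℤ[x] be a monic irreducible polynomial with n ≥ 2, let p be a prime, write n = p^r · t with p not dividing t, and let K = ℚ(α) for a complex root α of f. If p·t is odd, r ≥ p, and ν_p(1 + m) ≥ p + 1, then p divides the index (𝓞_K : ℤ[θ]) for every θ ∈ 𝓞_K generating K over ℚ; in particular K is not monogenic. -/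
open Polynomial

section A
variable {p : ℕ} [hp : Fact p.Prime]

theorem aux_binom {R : Type*} [CommRing R] (hodd : p ≠ 2) (d : R) :
    ∃ r, (1 + d) ^ p = 1 + p * d + p * d ^ 2 * r + d ^ p := by
  obtain ⟨q, hq⟩ : ∃ q, p = q + 3 := ⟨p - 3, by
    have := hp.1.two_le
    omega⟩
  refine ⟨∑ i ∈ Finset.range (q + 1), d ^ i * ((p.choose (i + 2) / p : ℕ) : R), ?_⟩
  rw [add_comm 1 d, add_pow, Finset.sum_range_succ, show p = q + 1 + 1 + 1 from hq,
    Finset.sum_range_succ', Finset.sum_range_succ', ← hq, Finset.mul_sum]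
  have : ∀ i ∈ Finset.range (q + 1), d ^ (i + 1 + 1) * 1 ^ (p - (i + 1 + 1)) * (p.choose (i + 1 + 1) : R)
      = p * d ^ 2 * (d ^ i * ((p.choose (i + 2) / p : ℕ) : R)) := by
    intro i hi
    have hi := Finset.mem_range.1 hi
    have h1 : p ∣ p.choose (i + 2) := hp.1.dvd_choose_self (by omega) (by omega)
    have h2 : (p.choose (i + 1 + 1) : R) = (p : R) * ((p.choose (i + 2) / p : ℕ) : R) := by
      rw [← Nat.cast_mul, Nat.mul_div_cancel' h1]
    rw [h2]; ring
  rw [Finset.sum_congr rfl this]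
  simp
  ring

theorem aux_binom' (hodd : p ≠ 2) (d : ℤ_[p]) (hd : (p : ℤ_[p]) ∣ d) :
    ∃ r, (1 + d) ^ p = 1 + p * d + p * d ^ 2 * r := by
  obtain ⟨r, hr⟩ := aux_binom (p := p) hodd d
  obtain ⟨e, he⟩ := hd
  obtain ⟨q, hq⟩ : ∃ q, p = q + 3 := ⟨p - 3, by
    have := hp.1.two_le
    omega⟩
  refine ⟨r + e * d ^ q, ?_⟩
  have : d ^ p = p * d ^ 2 * (e * d ^ q) := by
    calc d ^ p = d * (d ^ 2 * d ^ q) := by rw [show d ^ p = d ^ (q + 3) by rw [← hq]]; ring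
    _ = _ := by nth_rewrite 1 [he]; ring
  rw [hr, this]; ring

theorem norm_one_add_eq (x : ℤ_[p]) (hx : (p : ℤ_[p]) ∣ x) : ‖1 + x‖ = 1 := by
  have h := (PadicInt.norm_lt_one_iff_dvd x).2 hx
  rw [PadicInt.norm_add_eq_max_of_ne (by rw [norm_one]; exact h.ne')]
  simp [h.le]

theorem pth_root (hodd : p ≠ 2) (k : ℕ) (u : ℤ_[p]) (hu : (p : ℤ_[p]) ^ (k + 2) ∣ u - 1) :
    ∃ z : ℤ_[p], z ^ p = u ∧ (p : ℤ_[p]) ^ (k + 1) ∣ z - 1 := by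
  obtain ⟨e, he⟩ := hu
  set c : ℤ_[p] := p ^ (k + 1) * e with hc
  have hpc : (p : ℤ_[p]) ∣ c := ⟨p ^ k * e, by rw [hc]; ring⟩
  obtain ⟨r, hr⟩ := aux_binom' hodd c hpc
  have hpn : ‖(p : ℤ_[p])‖ < 1 := (PadicInt.norm_lt_one_iff_dvd _).2 dvd_rfl
  have hp0 : 0 < ‖(p : ℤ_[p])‖ := by
    rw [norm_pos_iff]; exact_mod_cast hp.1.ne_zero
  have hder : ‖(Polynomial.derivative ((X : ℤ_[p][X]) ^ p - C u)).aeval (1 + c)‖ = ‖(p : ℤ_[p])‖ := by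
    simp [norm_one_add_eq c hpc, derivative_X_pow]
  have hF : ((X : ℤ_[p][X]) ^ p - C u).aeval (1 + c) = p ^ 3 * (p ^ (k + k) * e ^ 2 * r) := by
    simp only [map_sub, map_pow, aeval_X, hr, aeval_C, Algebra.algebraMap_self, RingHom.id_apply]
    rw [show u = 1 + p ^ (k + 2) * e by rw [← he]; ring, hc]
    ring
  have hn : ‖((X : ℤ_[p][X]) ^ p - C u).aeval (1 + c)‖ <
      ‖(Polynomial.derivative ((X : ℤ_[p][X]) ^ p - C u)).aeval (1 + c)‖ ^ 2 := by
    rw [hder, hF, norm_mul, norm_pow]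
    calc ‖(p : ℤ_[p])‖ ^ 3 * _ ≤ ‖(p : ℤ_[p])‖ ^ 3 * 1 := by
          gcongr; exact PadicInt.norm_le_one _
      _ = ‖(p : ℤ_[p])‖ ^ 3 := mul_one _
      _ < _ := pow_lt_pow_right_of_lt_one₀ hp0 hpn (by norm_num)
  obtain ⟨z, hz, hza, -, -⟩ := hensels_lemma hn
  rw [hder] at hza
  have hz' : z ^ p = u := by simpa [sub_eq_zero] using hz
  have hpz : (p : ℤ_[p]) ∣ z - 1 := by
    have h1 := (PadicInt.norm_lt_one_iff_dvd _).1 (hza.trans hpn)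
    have := dvd_add h1 hpc
    convert this using 1; ring
  refine ⟨z, hz', ?_⟩
  obtain ⟨r', hr'⟩ := aux_binom' hodd (z - 1) hpz
  rw [show 1 + (z - 1) = z by ring, hz'] at hr'
  have hr2 : (p : ℤ_[p]) * (p ^ (k + 1) * e) = p * ((z - 1) * (1 + (z - 1) * r')) := by
    calc (p : ℤ_[p]) * (p ^ (k + 1) * e) = u - 1 := by rw [he]; ring
      _ = _ := by rw [hr']; ring
  have hr3 := mul_left_cancel₀ (by exact_mod_cast hp.1.ne_zero) hr2
  have hunit : IsUnit (1 + (z - 1) * r') := by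
    rw [PadicInt.isUnit_iff]
    exact norm_one_add_eq _ (hpz.mul_right r')
  rw [← hunit.dvd_mul_right]
  exact ⟨e, hr3.symm⟩

theorem ppow_root (hodd : p ≠ 2) (k : ℕ) : ∀ (u : ℤ_[p]), (p : ℤ_[p]) ^ (k + 1) ∣ u - 1 →
    ∃ z : ℤ_[p], z ^ (p ^ k) = u ∧ (p : ℤ_[p]) ∣ z - 1 := by
  induction k with
  | zero => intro u hu; exact ⟨u, by simp, by simpa using hu⟩
  | succ k ih =>
    intro u hu
    obtain ⟨z, hz, hz1⟩ := pth_root hodd k u hu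
    obtain ⟨y, hy, hy1⟩ := ih z hz1
    exact ⟨y, by rw [pow_succ, pow_mul, hy, hz], hy1⟩

theorem tth_root (t : ℕ) (ht : ¬ p ∣ t) (u : ℤ_[p]) (hu : (p : ℤ_[p]) ∣ u - 1) :
    ∃ z : ℤ_[p], z ^ t = u ∧ (p : ℤ_[p]) ∣ z - 1 := by
  have ht' : ‖(t : ℤ_[p])‖ = 1 := by
    apply le_antisymm (PadicInt.norm_le_one _)
    rw [← not_lt]
    intro h
    have := (PadicInt.norm_int_lt_one_iff_dvd (p := p) (t : ℤ)).1 (by simpa using h)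
    exact ht (by exact_mod_cast this)
  have hder : ‖(Polynomial.derivative ((X : ℤ_[p][X]) ^ t - C u)).aeval (1 : ℤ_[p])‖ = 1 := by
    simp [ht', derivative_X_pow]
  have hn : ‖((X : ℤ_[p][X]) ^ t - C u).aeval (1 : ℤ_[p])‖ <
      ‖(Polynomial.derivative ((X : ℤ_[p][X]) ^ t - C u)).aeval (1 : ℤ_[p])‖ ^ 2 := by
    rw [hder]
    simp only [map_sub, map_pow, aeval_X, aeval_C, Algebra.algebraMap_self, RingHom.id_apply, one_pow]
    rw [norm_sub_rev, PadicInt.norm_lt_one_iff_dvd]; exact hu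
  obtain ⟨z, hz, hza, -, -⟩ := hensels_lemma hn
  rw [hder] at hza
  exact ⟨z, by simpa [sub_eq_zero] using hz, (PadicInt.norm_lt_one_iff_dvd _).1 hza⟩

end A

theorem norm_le_one_of_int {p : ℕ} [hp : Fact p.Prime] (x : PadicAlgCl p) (hx : IsIntegral ℤ x) :
    ‖x‖ ≤ 1 := by
  have h := Valuation.Integers.mem_of_integral
    (Valuation.integer.integers (PadicAlgCl.valued p).v) (x := x) hx.tower_top
  have h2 : (PadicAlgCl.valued p).v x ≤ 1 := h
  rw [PadicAlgCl.valuation_def] at h2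
  exact_mod_cast h2

theorem place_sep {p : ℕ} [hp : Fact p.Prime] {K : Type*} [Field K] [NumberField K]
    (σ τ : K →+* PadicAlgCl p)
    (h : ∀ z : NumberField.RingOfIntegers K, ‖σ z‖ < 1 ↔ ‖τ z‖ < 1)
    (y : K) (hy : ‖σ y‖ ≤ 1) : ‖τ y‖ ≤ 1 := by
  have hint : ∀ (ρ : K →+* PadicAlgCl p) (z : NumberField.RingOfIntegers K), ‖ρ z‖ ≤ 1 := fun ρ z =>
    norm_le_one_of_int _ ((NumberField.RingOfIntegers.isIntegral_coe z).map (ρ.toIntAlgHom))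
  let P : Ideal (NumberField.RingOfIntegers K) :=
    { carrier := {z | ‖σ z‖ < 1}
      zero_mem' := by simp
      add_mem' := by
        intro a b ha hb
        simp only [Set.mem_ofPred_eq, map_add] at *
        exact (IsUltrametricDist.norm_add_le_max _ _).trans_lt (max_lt ha hb)
      smul_mem' := by
        intro a b hb
        simp only [Set.mem_ofPred_eq, smul_eq_mul, map_mul, norm_mul] at *
        exact (mul_le_of_le_one_left (norm_nonneg _) (hint σ a)).trans_lt hb }
  have hmem : ∀ z, z ∈ P ↔ ‖σ z‖ < 1 := fun z => Iff.rfl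
  have hone : ∀ z, z ∉ P → ‖σ z‖ = 1 := fun z hz => le_antisymm (hint σ z) (not_lt.1 hz)
  have hone' : ∀ z, z ∉ P → ‖τ z‖ = 1 := fun z hz =>
    le_antisymm (hint τ z) (not_lt.1 (fun h' => hz ((h z).2 h')))
  have hP : P.IsPrime := by
    rw [Ideal.isPrime_iff]
    constructor
    · rw [Ideal.ne_top_iff_one, hmem]; simp
    · intro a b hab
      by_contra! hc
      have := (hmem _).1 hab
      simp [hone a hc.1, hone b hc.2] at this
  have hpn : ‖(p : PadicAlgCl p)‖ < 1 := by
    have := PadicAlgCl.norm_extends p (p : ℚ_[p])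
    rw [map_natCast] at this
    rw [this]; exact Padic.norm_p_lt_one
  have hbot : P ≠ ⊥ := by
    intro hb
    have : (p : NumberField.RingOfIntegers K) ∈ P := by rw [hmem]; simpa using hpn
    rw [hb, Ideal.mem_bot] at this
    exact hp.1.ne_zero (by exact_mod_cast this)
  have := IsLocalization.AtPrime.isDiscreteValuationRing_of_dedekind_domain
    (NumberField.RingOfIntegers K) hbot (Localization.AtPrime P)
  obtain ⟨a, b, hb, rfl⟩ := IsFractionRing.div_surjective (A := NumberField.RingOfIntegers K) y
  have hb0 : b ≠ 0 := nonZeroDivisors.ne_zero hb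
  have hinj : Function.Injective (algebraMap (NumberField.RingOfIntegers K) (Localization.AtPrime P)) :=
    IsLocalization.injective _ P.primeCompl_le_nonZeroDivisors
  obtain ⟨c, hc⟩ := ValuationRing.cond (algebraMap _ (Localization.AtPrime P) a)
    (algebraMap _ (Localization.AtPrime P) b)
  obtain ⟨⟨d, s⟩, hds⟩ := IsLocalization.surj P.primeCompl c
  simp only at hds
  have hs := s.2
  change (s : NumberField.RingOfIntegers K) ∉ P at hs
  have hbσ : 0 < ‖σ b‖ := by simpa using hb0
  have hbτ : 0 < ‖τ b‖ := by simpa using hb0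
  change ‖σ (a / b)‖ ≤ 1 at hy
  change ‖τ (a / b)‖ ≤ 1
  rw [map_div₀, norm_div] at hy ⊢
  rw [div_le_one hbσ] at hy
  rw [div_le_one hbτ]
  rcases hc with hc | hc
  · -- `a * d = b * s`
    have e : a * d = b * s := hinj (by rw [map_mul, map_mul, ← hds, ← mul_assoc, hc])
    have e1 : ‖σ a‖ * ‖σ d‖ = ‖σ b‖ := by
      have := congrArg (fun z : NumberField.RingOfIntegers K => ‖σ z‖) e
      simpa [hone _ hs] using this
    have e2 : ‖τ a‖ * ‖τ d‖ = ‖τ b‖ := by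
      have := congrArg (fun z : NumberField.RingOfIntegers K => ‖τ z‖) e
      simpa [hone' _ hs] using this
    have hd : d ∉ P := by
      intro hd
      have := (hmem _).1 hd
      linarith [mul_le_mul_of_nonneg_right hy (norm_nonneg (σ d)), mul_lt_mul_of_pos_left this hbσ]
    rw [hone' d hd] at e2
    linarith
  · have e : b * d = a * s := hinj (by rw [map_mul, map_mul, ← hds, ← mul_assoc, hc])
    have e2 : ‖τ b‖ * ‖τ d‖ = ‖τ a‖ := by
      have := congrArg (fun z : NumberField.RingOfIntegers K => ‖τ z‖) e
      simpa [hone' _ hs] using this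
    rw [← e2]
    exact mul_le_of_le_one_right hbτ.le (hint τ d)

theorem norm_padicInt_coe {p : ℕ} [hp : Fact p.Prime] (a : ℤ_[p]) :
    ‖algebraMap ℚ_[p] (PadicAlgCl p) (a : ℚ_[p])‖ = ‖a‖ := by
  rw [norm_algebraMap', PadicInt.norm_def]

theorem eval_close {p : ℕ} [hp : Fact p.Prime] (g : ℤ[X]) (x : PadicAlgCl p) (a : ℤ_[p])
    (h : ‖x - algebraMap ℚ_[p] (PadicAlgCl p) (a : ℚ_[p])‖ < 1) :
    ‖aeval x g‖ < 1 ↔ ‖aeval a g‖ < 1 := by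
  set b := algebraMap ℚ_[p] (PadicAlgCl p) (a : ℚ_[p]) with hb
  have hb1 : ‖b‖ ≤ 1 := by rw [hb, norm_padicInt_coe]; exact PadicInt.norm_le_one a
  have hx1 : ‖x‖ ≤ 1 := by
    have := IsUltrametricDist.norm_add_le_max (x - b) b
    rw [sub_add_cancel] at this
    exact this.trans (max_le h.le hb1)
  have key : ‖aeval x g - aeval b g‖ < 1 := by
    induction g using Polynomial.induction_on' with
    | add f g hf hg =>
      rw [map_add, map_add, add_sub_add_comm]
      exact (IsUltrametricDist.norm_add_le_max _ _).trans_lt (max_lt hf hg)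
    | monomial n c =>
      rw [aeval_monomial, aeval_monomial, ← mul_sub, norm_mul]
      have hc : ‖algebraMap ℤ (PadicAlgCl p) c‖ ≤ 1 := by
        apply norm_le_one_of_int
        exact isIntegral_algebraMap
      refine (mul_le_of_le_one_left (norm_nonneg _) hc).trans_lt ?_
      induction n with
      | zero => simp
      | succ n ih =>
        rw [show x ^ (n + 1) - b ^ (n + 1) = x ^ n * (x - b) + (x ^ n - b ^ n) * b by ring]
        refine (IsUltrametricDist.norm_add_le_max _ _).trans_lt (max_lt ?_ ?_)
        · rw [norm_mul, norm_pow]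
          exact (mul_le_of_le_one_left (norm_nonneg _) (pow_le_one₀ (norm_nonneg _) hx1)).trans_lt h
        · rw [norm_mul]
          exact (mul_le_of_le_one_right (norm_nonneg _) hb1).trans_lt ih
  have e : ‖aeval a g‖ = ‖aeval b g‖ := by
    rw [← norm_padicInt_coe, hb]
    congr 1
    exact (Polynomial.aeval_algHom_apply
      ((algebraMap ℚ_[p] (PadicAlgCl p)).comp PadicInt.Coe.ringHom).toIntAlgHom a g).symm
  rw [e]
  constructor
  · intro h1
    have := IsUltrametricDist.norm_add_le_max (aeval x g) (-(aeval x g - aeval b g))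
    rw [← sub_eq_add_neg, sub_sub_cancel, norm_neg] at this
    exact this.trans_lt (max_lt h1 key)
  · intro h1
    have := IsUltrametricDist.norm_add_le_max (aeval x g - aeval b g) (aeval b g)
    rw [sub_add_cancel] at this
    exact this.trans_lt (max_lt key h1)

theorem norm_nat_eq_one {p : ℕ} [hp : Fact p.Prime] (t : ℕ) (ht : ¬ p ∣ t) :
    ‖(t : PadicAlgCl p)‖ = 1 := by
  have : ‖(t : ℤ_[p])‖ = 1 := by
    apply le_antisymm (PadicInt.norm_le_one _)
    rw [← not_lt]
    intro h
    have := (PadicInt.norm_int_lt_one_iff_dvd (p := p) (t : ℤ)).1 (by simpa using h)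
    exact ht (by exact_mod_cast this)
  rw [← this, ← norm_padicInt_coe]
  simp

theorem index_sep {p : ℕ} [hp : Fact p.Prime] {K : Type*} [Field K] [NumberField K]
    (σ τ : K →+* PadicAlgCl p) (θ : NumberField.RingOfIntegers K)
    (hidx : ¬ p ∣ (Subalgebra.toSubmodule (Algebra.adjoin ℤ {θ})).toAddSubgroup.index)
    (a : ℤ_[p])
    (h1 : ‖σ θ - algebraMap ℚ_[p] (PadicAlgCl p) (a : ℚ_[p])‖ < 1)
    (h2 : ‖τ θ - algebraMap ℚ_[p] (PadicAlgCl p) (a : ℚ_[p])‖ < 1)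
    (y : K) (hy : ‖σ y‖ ≤ 1) : ‖τ y‖ ≤ 1 := by
  refine place_sep σ τ ?_ y hy
  intro z
  have hz := AddSubgroup.nsmul_index_mem (Subalgebra.toSubmodule (Algebra.adjoin ℤ {θ})).toAddSubgroup z
  set N := (Subalgebra.toSubmodule (Algebra.adjoin ℤ {θ})).toAddSubgroup.index
  have hz' : N • z ∈ Algebra.adjoin ℤ {θ} := hz
  rw [Algebra.adjoin_singleton_eq_range_aeval] at hz'
  obtain ⟨g, hg⟩ := hz'
  have key : ∀ ρ : K →+* PadicAlgCl p, ‖ρ z‖ = ‖aeval (ρ θ) g‖ := by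
    intro ρ
    have : aeval (ρ θ) g = (N : PadicAlgCl p) * ρ z := by
      let φ : NumberField.RingOfIntegers K →ₐ[ℤ] PadicAlgCl p :=
        (ρ.comp (algebraMap (NumberField.RingOfIntegers K) K)).toIntAlgHom
      have h3 : φ (aeval θ g) = aeval (φ θ) g := (Polynomial.aeval_algHom_apply φ θ g).symm
      have h4 : (aeval θ) g = N • z := hg
      rw [h4, map_nsmul, nsmul_eq_mul] at h3
      exact h3.symm
    rw [this, norm_mul, norm_nat_eq_one N hidx, one_mul]
  rw [key σ, key τ, eval_close g _ a h1, eval_close g _ a h2]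

section C
variable {p : ℕ} [hp : Fact p.Prime]

theorem norm_p_lt : ‖(p : PadicAlgCl p)‖ < 1 := by
  have := PadicAlgCl.norm_extends p (p : ℚ_[p])
  rw [map_natCast] at this
  rw [this]; exact Padic.norm_p_lt_one

theorem norm_p_pos : 0 < ‖(p : PadicAlgCl p)‖ := by
  rw [norm_pos_iff]; exact_mod_cast hp.1.ne_zero

theorem norm_aeval_le (g : ℤ[X]) (x : PadicAlgCl p) (hx : ‖x‖ ≤ 1) : ‖aeval x g‖ ≤ 1 := by
  induction g using Polynomial.induction_on' with
  | add f g hf hg =>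
    rw [map_add]
    exact (IsUltrametricDist.norm_add_le_max _ _).trans (max_le hf hg)
  | monomial n c =>
    rw [aeval_monomial, norm_mul, norm_pow]
    have hc : ‖algebraMap ℤ (PadicAlgCl p) c‖ ≤ 1 := norm_le_one_of_int _ isIntegral_algebraMap
    exact mul_le_one₀ hc (by positivity) (pow_le_one₀ (norm_nonneg _) hx)

theorem bin_omega (hodd : p ≠ 2) (d : PadicAlgCl p) (hd : ‖d‖ ≤ 1) :
    ∃ ρ : PadicAlgCl p, ‖ρ‖ ≤ 1 ∧ (1 + d) ^ p = 1 + p * d * (1 + d * ρ) + d ^ p := by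
  obtain ⟨r, hr⟩ := aux_binom (p := p) hodd (X : ℤ[X])
  refine ⟨aeval d r, norm_aeval_le r d hd, ?_⟩
  have := congrArg (aeval d) hr
  simp only [map_add, map_mul, map_pow, map_one, aeval_X, map_natCast] at this
  rw [this]; ring

theorem norm_add_of_lt (x y : PadicAlgCl p) (h : ‖y‖ < ‖x‖) : ‖x + y‖ = ‖x‖ := by
  rw [IsUltrametricDist.norm_add_eq_max_of_norm_ne_norm h.ne', max_eq_left h.le]

theorem norm_one_add_mul (d ρ : PadicAlgCl p) (hd : ‖d‖ < 1) (hρ : ‖ρ‖ ≤ 1) : ‖1 + d * ρ‖ = 1 := by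
  rw [norm_add_of_lt, norm_one]
  rw [norm_one, norm_mul]
  exact (mul_le_of_le_one_right (norm_nonneg _) hρ).trans_lt hd

theorem root_norm (hodd : p ≠ 2) (x : PadicAlgCl p) (h1 : ‖(p : PadicAlgCl p)‖ ≤ ‖x ^ p - 1‖)
    (h2 : ‖x ^ p - 1‖ < 1) : ‖x - 1‖ ^ p = ‖x ^ p - 1‖ := by
  have hp0 : p ≠ 0 := hp.1.ne_zero
  have hx : ‖x‖ ≤ 1 := by
    have := IsUltrametricDist.norm_add_le_max (x ^ p - 1) 1
    rw [sub_add_cancel, norm_one, max_eq_right h2.le, norm_pow] at this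
    exact (pow_le_one_iff_of_nonneg (norm_nonneg _) hp0).1 this
  set d := x - 1 with hd
  have hd1 : ‖d‖ ≤ 1 := by
    have := IsUltrametricDist.norm_add_le_max x (-1)
    rw [norm_neg, norm_one, max_eq_right hx, ← sub_eq_add_neg] at this
    exact this
  obtain ⟨ρ, hρ, he⟩ := bin_omega hodd d hd1
  rw [show 1 + d = x by rw [hd]; ring] at he
  have h4 : ‖1 + d * ρ‖ ≤ 1 := by
    refine (IsUltrametricDist.norm_add_le_max _ _).trans (max_le norm_one.le ?_)
    rw [norm_mul]; exact mul_le_one₀ hd1 (norm_nonneg _) hρ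
  have h5 : ‖-(p * d * (1 + d * ρ))‖ ≤ ‖(p : PadicAlgCl p)‖ * ‖d‖ := by
    rw [norm_neg, norm_mul, norm_mul]
    exact mul_le_of_le_one_right (by positivity) h4
  have h3 : d ^ p = (x ^ p - 1) + -(p * d * (1 + d * ρ)) := by rw [he]; ring
  have hd2 : ‖d‖ < 1 := by
    have : ‖d ^ p‖ < 1 := by
      rw [h3]
      refine (IsUltrametricDist.norm_add_le_max _ _).trans_lt (max_lt h2 ?_)
      exact (h5.trans (mul_le_of_le_one_right (norm_nonneg _) hd1)).trans_lt norm_p_lt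
    rw [norm_pow] at this
    exact (pow_lt_one_iff_of_nonneg (norm_nonneg _) hp0).1 this
  rw [← norm_pow, h3, norm_add_of_lt]
  refine h5.trans_lt (lt_of_lt_of_le ?_ h1)
  exact mul_lt_of_lt_one_right norm_p_pos hd2

theorem root_norm_pow (hodd : p ≠ 2) (k : ℕ) : ∀ (x : PadicAlgCl p),
    ‖(p : PadicAlgCl p)‖ ≤ ‖x ^ (p ^ k) - 1‖ → ‖x ^ (p ^ k) - 1‖ < 1 →
    ‖x - 1‖ ^ (p ^ k) = ‖x ^ (p ^ k) - 1‖ := by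
  induction k with
  | zero => intro x _ _; simp
  | succ k ih =>
    intro x h1 h2
    have hp0 : p ^ k ≠ 0 := pow_ne_zero _ hp.1.ne_zero
    have e : x ^ (p ^ (k + 1)) = (x ^ p) ^ (p ^ k) := by rw [← pow_mul, pow_succ, mul_comm]
    rw [e] at h1 h2 ⊢
    have h := ih (x ^ p) h1 h2
    rw [← h] at h1 h2 ⊢
    have h3 : ‖x ^ p - 1‖ < 1 := (pow_lt_one_iff_of_nonneg (norm_nonneg _) hp0).1 h2
    have h4 : ‖(p : PadicAlgCl p)‖ ≤ ‖x ^ p - 1‖ :=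
      h1.trans (pow_le_of_le_one (norm_nonneg _) h3.le hp0)
    rw [← root_norm hodd x h4 h3, ← pow_mul, pow_succ, mul_comm]

theorem zeta_norm (hodd : p ≠ 2) (η : PadicAlgCl p) (h1 : η ^ p = 1) (hne : η ≠ 1) :
    ‖η - 1‖ ^ (p - 1) = ‖(p : PadicAlgCl p)‖ := by
  have hp0 : p ≠ 0 := hp.1.ne_zero
  have hx : ‖η‖ ≤ 1 := by
    apply (pow_le_one_iff_of_nonneg (norm_nonneg _) hp0).1
    rw [← norm_pow, h1, norm_one]
  set d := η - 1 with hd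
  have hd0 : d ≠ 0 := sub_ne_zero.2 hne
  have hd1 : ‖d‖ ≤ 1 := by
    have := IsUltrametricDist.norm_add_le_max η (-1)
    rw [norm_neg, norm_one, max_eq_right hx, ← sub_eq_add_neg] at this
    exact this
  obtain ⟨ρ, hρ, he⟩ := bin_omega hodd d hd1
  rw [show 1 + d = η by rw [hd]; ring, h1] at he
  have h4 : ‖1 + d * ρ‖ ≤ 1 := by
    refine (IsUltrametricDist.norm_add_le_max _ _).trans (max_le norm_one.le ?_)
    rw [norm_mul]; exact mul_le_one₀ hd1 (norm_nonneg _) hρ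
  have h3 : d ^ p = -(p * d * (1 + d * ρ)) := by linear_combination -he
  have h3n : ‖d‖ ^ p = ‖(p : PadicAlgCl p)‖ * ‖d‖ * ‖1 + d * ρ‖ := by
    rw [← norm_pow, h3, norm_neg, norm_mul, norm_mul]
  have hd2 : ‖d‖ < 1 := by
    apply (pow_lt_one_iff_of_nonneg (norm_nonneg _) hp0).1
    rw [h3n]
    refine lt_of_le_of_lt ?_ (norm_p_lt (p := p))
    rw [mul_assoc]
    exact mul_le_of_le_one_right (norm_nonneg _) (mul_le_one₀ hd1 (norm_nonneg _) h4)
  rw [norm_one_add_mul d ρ hd2 hρ, mul_one] at h3n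
  have hd3 : ‖d‖ ≠ 0 := norm_ne_zero_iff.2 hd0
  apply mul_right_cancel₀ hd3
  rw [← h3n, ← pow_succ, Nat.sub_add_cancel hp.1.one_le]

/-- Integral elements of `ℚ_p(ω)` are congruent to `p`-adic integers. -/
def Good (ω : PadicAlgCl p) : Prop :=
  ∀ y ∈ Algebra.adjoin ℚ_[p] {ω}, ‖y‖ ≤ 1 →
    ∃ a : ℤ_[p], ‖y - algebraMap ℚ_[p] (PadicAlgCl p) (a : ℚ_[p])‖ < 1

theorem good_coe (a : ℚ_[p]) : Good (algebraMap ℚ_[p] (PadicAlgCl p) a) := by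
  intro y hy hn
  have : Algebra.adjoin ℚ_[p] {algebraMap ℚ_[p] (PadicAlgCl p) a} = ⊥ := by
    rw [eq_bot_iff, Algebra.adjoin_le_iff]
    rintro _ rfl
    exact Subalgebra.algebraMap_mem _ _
  rw [this, Algebra.mem_bot] at hy
  obtain ⟨b, rfl⟩ := hy
  rw [norm_algebraMap'] at hn
  exact ⟨⟨b, hn⟩, by simp⟩

theorem term_norm (N : ℕ) (π : PadicAlgCl p) (hπ : ‖π‖ ^ N = ‖(p : PadicAlgCl p)‖)
    (c : ℚ_[p]) (hc : c ≠ 0) (i : ℕ) :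
    ‖algebraMap ℚ_[p] (PadicAlgCl p) c * π ^ i‖ ^ N = (p : ℝ) ^ (-((i : ℤ) + N * c.valuation)) := by
  have hp0 : (p : ℝ) ≠ 0 := by exact_mod_cast hp.1.ne_zero
  have hpn : ‖(p : PadicAlgCl p)‖ = (p : ℝ)⁻¹ := by
    have := PadicAlgCl.norm_extends p (p : ℚ_[p])
    rw [map_natCast] at this
    rw [this]; exact Padic.norm_p
  have e1 : (p : ℝ) ^ (-((i : ℤ) + N * c.valuation)) =
      ((p : ℝ) ^ (-c.valuation)) ^ N * ((p : ℝ)⁻¹) ^ i := by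
    rw [← zpow_natCast, ← zpow_mul, ← zpow_natCast, ← zpow_neg_one, ← zpow_mul, ← zpow_add₀ hp0]
    congr 1
    ring
  rw [e1, norm_mul, norm_pow, norm_algebraMap', mul_pow, ← pow_mul, mul_comm i N, pow_mul, hπ, hpn,
    Padic.norm_eq_zpow_neg_valuation hc]

theorem good_of (N : ℕ) (hN : 0 < N) (ω : PadicAlgCl p) (hω : ‖ω - 1‖ ^ N = ‖(p : PadicAlgCl p)‖)
    (P : ℚ_[p][X]) (hP : P.Monic) (hdeg : P.natDegree = N) (hroot : aeval ω P = 0) : Good ω := by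
  classical
  intro y hy hn
  have hp1 : (1 : ℝ) < p := by exact_mod_cast hp.1.one_lt
  have hinj : Function.Injective (fun z : ℤ => (p : ℝ) ^ z) := (zpow_right_strictMono₀ hp1).injective
  rw [Algebra.adjoin_singleton_eq_range_aeval] at hy
  obtain ⟨g, rfl⟩ := hy
  change ‖aeval ω g‖ ≤ 1 at hn
  change ∃ a : ℤ_[p], ‖aeval ω g - _‖ < 1
  set π := ω - 1 with hπ
  have hcomp : ∀ f : ℚ_[p][X], aeval π (f.comp (X + C 1)) = aeval ω f := by
    intro f
    rw [aeval_comp]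
    simp [hπ]
  have hP1 : (P.comp (X + C 1)).Monic := hP.comp_X_add_C 1
  have hP1d : (P.comp (X + C 1)).natDegree = N := by
    rw [natDegree_comp, natDegree_X_add_C, mul_one, hdeg]
  set h := g.comp (X + C 1) %ₘ P.comp (X + C 1) with hh
  have hval : aeval ω g = aeval π h := by
    rw [← hcomp g, hh, aeval_modByMonic_eq_self_of_root]
    rw [hcomp, hroot]
  have hhd : h.natDegree < N := by
    rw [← hP1d]
    apply natDegree_modByMonic_lt _ hP1
    intro h1
    rw [h1, natDegree_one] at hP1d
    omega
  have hsum : aeval π h = ∑ i ∈ Finset.range N, algebraMap ℚ_[p] (PadicAlgCl p) (h.coeff i) * π ^ i := by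
    rw [aeval_eq_sum_range' hhd]
    simp [Algebra.smul_def]
  rw [hval] at hn ⊢
  set f : ℕ → PadicAlgCl p := fun i => algebraMap ℚ_[p] (PadicAlgCl p) (h.coeff i) * π ^ i with hf
  set s := (Finset.range N).filter (fun i => h.coeff i ≠ 0) with hs
  have hsum2 : aeval π h = ∑ i ∈ s, f i := by
    rw [hsum, hs, Finset.sum_filter_of_ne]
    intro i _ hi h0
    exact hi (by simp only [hf, h0, map_zero, zero_mul])
  have hpair : Set.Pairwise (s : Set ℕ) (fun i j ↦ ‖f i‖₊ ≠ ‖f j‖₊) := by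
    intro i hi j hj hij heq
    simp only [hs, Finset.coe_filter, Finset.mem_range, Set.mem_ofPred_eq] at hi hj
    have heq' : ‖f i‖ ^ N = ‖f j‖ ^ N := by
      rw [← coe_nnnorm, ← coe_nnnorm, heq]
    rw [hf] at heq'
    simp only at heq'
    rw [term_norm N π hω _ hi.2, term_norm N π hω _ hj.2] at heq'
    have h1 := neg_injective (hinj heq')
    have h2 := congrArg (· % (N : ℤ)) h1
    simp only [Int.add_mul_emod_self_left] at h2
    rw [Int.emod_eq_of_lt (by omega) (by omega), Int.emod_eq_of_lt (by omega) (by omega)] at h2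
    exact hij (by exact_mod_cast h2)
  have hle : ∀ i ∈ s, ‖f i‖ ≤ 1 := by
    intro i hi
    have h1 := IsUltrametricDist.nnnorm_sum_eq_sup_of_pairwise_ne hpair
    have h2 : ‖f i‖₊ ≤ s.sup (fun i => ‖f i‖₊) := Finset.le_sup (f := fun i => ‖f i‖₊) hi
    rw [← h1, ← hsum2] at h2
    exact le_trans (by exact_mod_cast h2) hn
  have hlt : ∀ i ∈ s, i ≠ 0 → ‖f i‖ < 1 := by
    intro i hi hi0
    refine lt_of_le_of_ne (hle i hi) ?_
    intro h1
    simp only [hs, Finset.mem_filter, Finset.mem_range] at hi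
    have h2 := term_norm N π hω _ hi.2 i
    change ‖f i‖ ^ N = _ at h2
    rw [h1, one_pow, ← zpow_zero (p : ℝ)] at h2
    have h3 := hinj h2
    have h4 : (i : ℤ) + N * (h.coeff i).valuation = 0 := by simpa using (neg_eq_zero.1 h3.symm)
    have h5 := congrArg (· % (N : ℤ)) h4
    simp only [Int.add_mul_emod_self_left, Int.zero_emod] at h5
    rw [Int.emod_eq_of_lt (by omega) (by omega)] at h5
    exact hi0 (by exact_mod_cast h5)
  have h0 : ‖h.coeff 0‖ ≤ 1 := by
    by_cases hc : h.coeff 0 = 0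
    · simp [hc]
    · have := hle 0 (by simp [hs, hN, hc])
      simpa [hf] using this
  refine ⟨⟨h.coeff 0, h0⟩, ?_⟩
  have : aeval π h - algebraMap ℚ_[p] (PadicAlgCl p) (h.coeff 0)
      = ∑ i ∈ Finset.range (N - 1), f (i + 1) := by
    obtain ⟨M, rfl⟩ : ∃ M, N = M + 1 := ⟨N - 1, by omega⟩
    rw [hsum, Finset.sum_range_succ']
    simp [hf]
  change ‖aeval π h - algebraMap ℚ_[p] (PadicAlgCl p) (h.coeff 0)‖ < 1
  rw [this]
  have hlt' : ∀ i ∈ Finset.range (N - 1), ‖f (i + 1)‖ < 1 := by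
    intro i hi
    have hi := Finset.mem_range.1 hi
    by_cases hc : h.coeff (i + 1) = 0
    · simp [hf, hc]
    · exact hlt _ (by simp [hs, hc]; omega) (by omega)
  obtain ⟨i, hi, hi2⟩ := IsUltrametricDist.exists_norm_finsetSum_le (Finset.range (N - 1)) (fun i => f (i + 1))
  by_cases hne : (Finset.range (N - 1)).Nonempty
  · exact hi2.trans_lt (hlt' i (hi hne))
  · rw [Finset.not_nonempty_iff_eq_empty.1 hne]; simp

/-- the image of a `p`-adic integer -/
noncomputable abbrev emb (w : ℤ_[p]) : PadicAlgCl p := algebraMap ℚ_[p] (PadicAlgCl p) (w : ℚ_[p])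

theorem emb_pow (w : ℤ_[p]) (k : ℕ) : emb (w ^ k) = emb w ^ k := by
  unfold emb
  rw [PadicInt.coe_pow, map_pow]

theorem emb_sub_one (w : ℤ_[p]) : ‖emb w - 1‖ = ‖w - 1‖ := by
  rw [← norm_padicInt_coe]; simp

theorem norm_p_eq : ‖(p : PadicAlgCl p)‖ = ‖(p : ℤ_[p])‖ := by
  rw [← norm_padicInt_coe]; simp

theorem emb_sub_one_le (w : ℤ_[p]) (hw : (p : ℤ_[p]) ∣ w - 1) :
    ‖emb w - 1‖ ≤ ‖(p : PadicAlgCl p)‖ := by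
  rw [emb_sub_one, norm_p_eq]
  obtain ⟨e, he⟩ := hw
  rw [he, norm_mul]
  exact mul_le_of_le_one_right (norm_nonneg _) (PadicInt.norm_le_one _)

theorem good_zero (hodd : p ≠ 2) (k : ℕ) : ∀ (w : ℤ_[p]), (p : ℤ_[p]) ∣ w - 1 →
    ∃ ω : PadicAlgCl p, ω ^ (p ^ k) = emb w ∧ Good ω := by
  induction k with
  | zero => intro w _; exact ⟨emb w, by simp, good_coe _⟩
  | succ k ih =>
    intro w hw
    by_cases h2 : (p : ℤ_[p]) ^ (0 + 2) ∣ w - 1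
    · obtain ⟨z, hz, hz1⟩ := pth_root hodd 0 w h2
      obtain ⟨ω, hω, hg⟩ := ih z (by simpa using hz1)
      exact ⟨ω, by rw [pow_succ, pow_mul, hω, ← hz, emb_pow], hg⟩
    · have hpos : 0 < p ^ (k + 1) := pow_pos hp.1.pos _
      obtain ⟨ω, hω⟩ := IsAlgClosed.exists_pow_nat_eq (emb w) hpos
      refine ⟨ω, hω, ?_⟩
      have hn : ‖emb w - 1‖ = ‖(p : PadicAlgCl p)‖ := by
        rw [emb_sub_one, norm_p_eq]
        obtain ⟨e, he⟩ := hw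
        rw [he, norm_mul]
        have : ‖e‖ = 1 := by
          apply le_antisymm (PadicInt.norm_le_one _)
          rw [← not_lt, PadicInt.norm_lt_one_iff_dvd]
          rintro ⟨e', he'⟩
          exact h2 ⟨e', by rw [he, he']; ring⟩
        rw [this, mul_one]
      refine good_of (p ^ (k + 1)) hpos ω ?_ (X ^ (p ^ (k + 1)) - C (w : ℚ_[p]))
        (monic_X_pow_sub_C _ hpos.ne') natDegree_X_pow_sub_C ?_
      · rw [root_norm_pow hodd (k + 1) ω (by rw [hω, hn]) (by rw [hω, hn]; exact norm_p_lt), hω, hn]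
      · simp [hω]

theorem geom_poly (M : ℕ) (hM : 0 < M) (W : ℚ_[p]) : ∃ R : ℚ_[p][X],
    (∑ i ∈ Finset.range p, (X ^ M) ^ i * C W ^ (p - 1 - i)) = X ^ (M * (p - 1)) + R ∧
    R.degree < ((M * (p - 1) : ℕ) : WithBot ℕ) := by
  refine ⟨∑ i ∈ Finset.range (p - 1), (X ^ M) ^ i * C W ^ (p - 1 - i), ?_, ?_⟩
  · have : Finset.range p = Finset.range (p - 1 + 1) := by rw [Nat.sub_add_cancel hp.1.one_le]
    rw [this, Finset.sum_range_succ, add_comm]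
    simp [pow_mul]
  · rw [← mem_degreeLT]
    refine Submodule.sum_mem _ ?_
    intro i hi
    have hi := Finset.mem_range.1 hi
    rw [mem_degreeLT, ← pow_mul, ← C_pow, X_pow_mul_C]
    refine (degree_C_mul_X_pow_le _ _).trans_lt ?_
    exact_mod_cast Nat.mul_lt_mul_of_pos_left hi hM

theorem family (hodd : p ≠ 2) (k : ℕ) (w : ℤ_[p]) (hw : (p : ℤ_[p]) ∣ w - 1) (j : ℕ) :
    ∃ ω : PadicAlgCl p, ω ^ (p ^ k * p ^ j) = emb w ^ (p ^ j) ∧ Good ω ∧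
      ∀ i < j, ‖(p : PadicAlgCl p)‖ < ‖ω ^ (p ^ k * p ^ i) - 1‖ := by
  cases j with
  | zero =>
    obtain ⟨ω, h1, h2⟩ := good_zero hodd k w hw
    exact ⟨ω, by simpa using h1, h2, by simp⟩
  | succ j =>
    have hp2 := hp.1.two_le
    obtain ⟨η, hη⟩ := IsAlgClosed.exists_root (cyclotomic p (PadicAlgCl p))
      (by rw [degree_cyclotomic]; exact_mod_cast (Nat.totient_pos.2 hp.1.pos).ne')
    have : NeZero (p : PadicAlgCl p) := ⟨by exact_mod_cast hp.1.ne_zero⟩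
    rw [isRoot_cyclotomic_iff] at hη
    have hη1 : η ^ p = 1 := hη.pow_eq_one
    have hηne : η ≠ 1 := hη.ne_one hp.1.one_lt
    have hzn := zeta_norm hodd η hη1 hηne
    set W : ℤ_[p] := w ^ (p ^ j) with hW
    have hWd : (p : ℤ_[p]) ∣ W - 1 := by
      have := sub_dvd_pow_sub_pow w 1 (p ^ j)
      rw [one_pow] at this
      exact hw.trans this
    have hη_lt : ‖η - 1‖ < 1 := by
      apply (pow_lt_one_iff_of_nonneg (norm_nonneg _) (n := p - 1) (by omega)).1
      rw [hzn]; exact norm_p_lt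
    have hη_gt : ‖(p : PadicAlgCl p)‖ < ‖η - 1‖ := by
      rw [← hzn]
      have h0 : 0 < ‖η - 1‖ := norm_pos_iff.2 (sub_ne_zero.2 hηne)
      conv_rhs => rw [← pow_one ‖η - 1‖]
      exact pow_lt_pow_right_of_lt_one₀ h0 hη_lt (by omega)
    have hηn : ‖η‖ = 1 := by
      rw [← sub_add_cancel η 1, add_comm, norm_add_of_lt, norm_one]
      rw [norm_one]; exact hη_lt
    have hηW : ‖η * emb W - 1‖ = ‖η - 1‖ := by
      rw [show η * emb W - 1 = (η - 1) + η * (emb W - 1) by ring]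
      apply norm_add_of_lt
      rw [norm_mul, hηn, one_mul]
      exact (emb_sub_one_le W hWd).trans_lt hη_gt
    have hpos : 0 < p ^ (k + j) := pow_pos hp.1.pos _
    obtain ⟨ω, hω⟩ := IsAlgClosed.exists_pow_nat_eq (η * emb W) hpos
    refine ⟨ω, ?_, ?_, ?_⟩
    · rw [show p ^ k * p ^ (j + 1) = p ^ (k + j) * p by ring, pow_mul, hω, mul_pow, hη1, one_mul, hW,
        emb_pow, ← pow_mul, pow_succ]
    · obtain ⟨R, hPeq, hrest⟩ := geom_poly (p ^ (k + j)) hpos (W : ℚ_[p])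
      refine good_of (p ^ (k + j) * (p - 1)) (Nat.mul_pos hpos (by omega)) ω ?_
        (∑ i ∈ Finset.range p, (X ^ (p ^ (k + j))) ^ i * C (W : ℚ_[p]) ^ (p - 1 - i)) ?_ ?_ ?_
      · rw [pow_mul, root_norm_pow hodd, hω, hηW, hzn]
        · rw [hω, hηW]; exact hη_gt.le
        · rw [hω, hηW]; exact hη_lt
      · rw [hPeq]; exact monic_X_pow_add hrest
      · rw [hPeq]; exact natDegree_eq_of_degree_eq_some (by
          rw [degree_add_eq_left_of_degree_lt (by rwa [degree_X_pow]), degree_X_pow])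
      · have hWne : emb W ≠ 0 := by
          intro h0
          have := emb_sub_one_le W hWd
          rw [h0] at this
          simp only [zero_sub, norm_neg, norm_one] at this
          exact absurd norm_p_lt (not_lt.2 this)
        have hgeo := (Commute.all (ω ^ (p ^ (k + j))) (emb W)).geom_sum₂_mul p
        have hz : (ω ^ (p ^ (k + j))) ^ p - emb W ^ p = 0 := by
          rw [hω, mul_pow, hη1, one_mul, sub_self]
        rw [hz, mul_eq_zero] at hgeo
        rcases hgeo with h | h
        · simpa using h
        · exfalso
          rw [hω, sub_eq_zero] at h
          exact hηne (mul_right_cancel₀ hWne (by rw [h, one_mul]))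
    · intro i hi
      by_contra! hc
      have h1 : (ω ^ (p ^ k * p ^ i)) ^ (p ^ (j - i)) = η * emb W := by
        rw [← pow_mul, ← hω, ← pow_add, ← pow_add]
        congr 2
        omega
      have h2 := root_norm_pow hodd (j - i) (ω ^ (p ^ k * p ^ i))
        (by rw [h1, hηW]; exact hη_gt.le) (by rw [h1, hηW]; exact hη_lt)
      rw [h1, hηW] at h2
      have h3 := pow_le_of_le_one (norm_nonneg (ω ^ (p ^ k * p ^ i) - 1)) (hc.trans norm_p_lt.le)
        (n := p ^ (j - i)) (pow_ne_zero _ hp.1.ne_zero)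
      linarith

end C

theorem exists_emb {p : ℕ} [hp : Fact p.Prime] {K : Type*} [Field K] [NumberField K] (n : ℕ) (m : ℤ)
    (hn : 2 ≤ n) (hirr : Irreducible ((X : ℤ[X]) ^ n - C m))
    (α : K) (hroot : Polynomial.aeval α ((X : ℤ[X]) ^ n - C m) = 0)
    (hgen : Algebra.adjoin ℚ {α} = ⊤) (x : PadicAlgCl p) (hx : x ^ n = (m : PadicAlgCl p)) :
    ∃ σ : K →+* PadicAlgCl p, σ α = x ∧ ∀ y, σ y ∈ Algebra.adjoin ℚ_[p] {x} := by
  have hmon : ((X : ℤ[X]) ^ n - C m).Monic := monic_X_pow_sub_C m (by omega)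
  have hirr' : Irreducible ((X : ℚ[X]) ^ n - C (m : ℚ)) := by
    have := (hmon.irreducible_iff_irreducible_map_fraction_map (K := ℚ)).1 hirr
    simpa using this
  have hmin : minpoly ℚ α = (X : ℚ[X]) ^ n - C (m : ℚ) := by
    symm
    apply minpoly.eq_of_irreducible_of_monic hirr'
    · simpa using hroot
    · exact monic_X_pow_sub_C _ (by omega)
  have hxr : aeval x (minpoly ℚ α) = 0 := by
    rw [hmin]; simp [hx]
  let φ := Algebra.adjoin.liftSingleton ℚ α x hxr
  have hmem : ∀ y : K, y ∈ Algebra.adjoin ℚ {α} := fun y => by rw [hgen]; trivial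
  let ι : K →ₐ[ℚ] Algebra.adjoin ℚ {α} := (AlgHom.id ℚ K).codRestrict _ hmem
  have hα : φ (ι α) = x := by
    have h1 : AlgEquiv.adjoinSingletonEquivAdjoinRootMinpoly ℚ α (ι α) =
        AdjoinRoot.root (minpoly ℚ α) := by
      rw [← AlgEquiv.eq_symm_apply]
      apply Subtype.ext
      simp [AlgEquiv.adjoinSingletonEquivAdjoinRootMinpoly, ι]
      rfl
    change AdjoinRoot.liftAlgHom _ _ x hxr
      (AlgEquiv.adjoinSingletonEquivAdjoinRootMinpoly ℚ α (ι α)) = x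
    rw [h1]
    exact AdjoinRoot.liftAlgHom_root _ _ _ _
  refine ⟨(φ.comp ι).toRingHom, hα, ?_⟩
  intro y
  have hy := hmem y
  rw [Algebra.adjoin_singleton_eq_range_aeval] at hy
  obtain ⟨g, rfl⟩ := hy
  change (φ.comp ι) (aeval α g) ∈ _
  rw [← Polynomial.aeval_algHom_apply]
  change aeval (φ (ι α)) g ∈ _
  rw [hα, ← Polynomial.aeval_map_algebraMap ℚ_[p]]
  exact Polynomial.aeval_mem_adjoin_singleton _ _

theorem index_dvd {K : Type*} [Field K] [NumberField K] (n : ℕ) (m : ℤ) (hn : 2 ≤ n)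
    (hirr : Irreducible ((X : ℤ[X]) ^ n - C m))
    (α : K) (hroot : Polynomial.aeval α ((X : ℤ[X]) ^ n - C m) = 0)
    (hgen : Algebra.adjoin ℚ {α} = ⊤)
    (p r t : ℕ) (hp : p.Prime)
    (hnrt : n = p ^ r * t) (hpt : ¬ p ∣ t)
    (hodd : Odd (p * t)) (hrp : r ≥ p) (hval : padicValInt p (1 + m) ≥ p + 1)
    (θ : NumberField.RingOfIntegers K) :
    p ∣ (Subalgebra.toSubmodule (Algebra.adjoin ℤ {θ})).toAddSubgroup.index := by
  have : Fact p.Prime := ⟨hp⟩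
  obtain ⟨hpo, hto⟩ := Nat.odd_mul.1 hodd
  have hp2 : p ≠ 2 := by rintro rfl; exact absurd hpo (by decide)
  have hno : Odd n := by rw [hnrt]; exact (hpo.pow).mul hto
  have hu : (p : ℤ_[p]) ^ (p + 1) ∣ ((-m : ℤ) : ℤ_[p]) - 1 := by
    have h1 : (p : ℤ) ^ (p + 1) ∣ 1 + m := (padicValInt_dvd_iff (p + 1) (1 + m)).2 (Or.inr hval)
    have h2 := map_dvd (Int.castRingHom ℤ_[p]) h1
    have h3 := (dvd_neg).2 h2
    convert h3 using 1
    · simp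
    · simp; ring
  obtain ⟨w1, hw1, hw1d⟩ := ppow_root hp2 p _ hu
  obtain ⟨w, hw, hwd⟩ := tth_root t hpt w1 hw1d
  have hwu : w ^ (p ^ p * t) = ((-m : ℤ) : ℤ_[p]) := by
    rw [mul_comm, pow_mul, hw, hw1]
  choose ω hω hgood hsep using family hp2 (r - p) w hwd
  have hωn : ∀ j ≤ p, (-ω j) ^ n = (m : PadicAlgCl p) := by
    intro j hj
    have e : n = p ^ (r - p) * p ^ j * (p ^ (p - j) * t) := by
      rw [hnrt, ← mul_assoc, ← pow_add, ← pow_add]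
      congr 2
      omega
    rw [hno.neg_pow, e, pow_mul, hω, ← pow_mul, ← mul_assoc, ← pow_add, Nat.add_sub_cancel' hj,
      ← emb_pow, hwu]
    unfold emb
    simp
  have hσ : ∀ j : Fin (p + 1), ∃ σ : K →+* PadicAlgCl p, σ α = -ω j ∧
      ∀ y, σ y ∈ Algebra.adjoin ℚ_[p] {-ω j} := fun j =>
    exists_emb n m hn hirr α hroot hgen (-ω j) (hωn j (by omega))
  choose σ hσα hσm using hσ
  have hadj : ∀ x : PadicAlgCl p, Algebra.adjoin ℚ_[p] {-x} ≤ Algebra.adjoin ℚ_[p] {x} := by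
    intro x
    rw [Algebra.adjoin_le_iff, Set.singleton_subset_iff]
    exact neg_mem (Algebra.self_mem_adjoin_singleton _ _)
  have hres : ∀ j : Fin (p + 1), ∃ a : ℤ_[p],
      ‖σ j θ - algebraMap ℚ_[p] (PadicAlgCl p) (a : ℚ_[p])‖ < 1 := fun j =>
    hgood j _ (hadj _ (hσm j θ)) (norm_le_one_of_int _
      ((NumberField.RingOfIntegers.isIntegral_coe θ).map ((σ j).toIntAlgHom)))
  choose a ha using hres
  obtain ⟨j, k, hjk, hajk⟩ : ∃ j k, j < k ∧ PadicInt.toZMod (a j) = PadicInt.toZMod (a k) := by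
    obtain ⟨j, k, hne, h⟩ := Fintype.exists_ne_map_eq_of_card_lt (fun j => PadicInt.toZMod (a j))
      (by rw [ZMod.card, Fintype.card_fin]; omega)
    rcases lt_or_gt_of_ne hne with h' | h'
    · exact ⟨j, k, h', h⟩
    · exact ⟨k, j, h', h.symm⟩
  have hak : ‖σ k θ - algebraMap ℚ_[p] (PadicAlgCl p) (a j : ℚ_[p])‖ < 1 := by
    have h1 : ‖a k - a j‖ < 1 := by
      have : a k - a j ∈ RingHom.ker (PadicInt.toZMod (p := p)) := by
        rw [RingHom.mem_ker, map_sub, hajk, sub_self]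
      rw [PadicInt.ker_toZMod, PadicInt.maximalIdeal_eq_span_p, Ideal.mem_span_singleton] at this
      exact (PadicInt.norm_lt_one_iff_dvd _).2 this
    rw [← norm_padicInt_coe, PadicInt.coe_sub, map_sub] at h1
    have := IsUltrametricDist.norm_add_le_max
      (σ k θ - algebraMap ℚ_[p] (PadicAlgCl p) (a k : ℚ_[p]))
      (algebraMap ℚ_[p] (PadicAlgCl p) (a k : ℚ_[p]) - algebraMap ℚ_[p] (PadicAlgCl p) (a j : ℚ_[p]))
    rw [sub_add_sub_cancel] at this
    exact this.trans_lt (max_lt (ha k) h1)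
  by_contra hidx
  have hp0 : 0 < ‖(p : PadicAlgCl p)‖ := norm_p_pos
  have hev : ∀ l : Fin (p + 1), σ l (((-α) ^ (p ^ (r - p) * p ^ (j : ℕ)) - 1) / (p : K)) =
      (ω l ^ (p ^ (r - p) * p ^ (j : ℕ)) - 1) / (p : PadicAlgCl p) := by
    intro l
    rw [map_div₀, map_sub, map_pow, map_neg, hσα, neg_neg, map_one, map_natCast]
  have hfin := index_sep (σ j) (σ k) θ hidx (a j) (ha j) hak
    (((-α) ^ (p ^ (r - p) * p ^ (j : ℕ)) - 1) / (p : K)) (by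
      rw [hev, norm_div, div_le_one hp0, hω, ← emb_pow]
      apply emb_sub_one_le
      have := sub_dvd_pow_sub_pow w 1 (p ^ (j : ℕ))
      rw [one_pow] at this
      exact hwd.trans this)
  rw [hev, norm_div, div_le_one hp0] at hfin
  exact absurd (hsep k j hjk) (not_lt.2 hfin)



/-- Let `f(x) = x^n - m` be monic irreducible, `n ≥ 2`, `p` a prime, `n = p^r·t` with
`p ∤ t`, and `K = ℚ(α)` for a root `α` of `f`. If `p·t` is odd, `r ≥ p`, and
`ν_p(1+m) ≥ p+1`, then `p` divides `(𝓞_K : ℤ[θ])` for every generator `θ ∈ 𝓞_K` of `K`;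
in particular `K` is not monogenic. -/
theorem not_monogenic_case2
    {K : Type*} [Field K] [NumberField K] (n : ℕ) (m : ℤ) (hn : 2 ≤ n)
    (hirr : Irreducible ((X : ℤ[X]) ^ n - C m))
    (α : K) (hroot : Polynomial.aeval α ((X : ℤ[X]) ^ n - C m) = 0)
    (hgen : Algebra.adjoin ℚ {α} = ⊤)
    (p r t : ℕ) (hp : p.Prime)
    (hnrt : n = p ^ r * t) (hpt : ¬ p ∣ t)
    (hodd : Odd (p * t)) (hrp : r ≥ p) (hval : padicValInt p (1 + m) ≥ p + 1) :
    (∀ θ : NumberField.RingOfIntegers K, Algebra.adjoin ℚ {(θ : K)} = ⊤ →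
        p ∣ (Subalgebra.toSubmodule (Algebra.adjoin ℤ {θ})).toAddSubgroup.index) ∧
      ¬ ∃ θ : NumberField.RingOfIntegers K, Algebra.adjoin ℤ {θ} = ⊤ := by
  have key := index_dvd n m hn hirr α hroot hgen p r t hp hnrt hpt hodd hrp hval
  refine ⟨fun θ _ => key θ, ?_⟩
  rintro ⟨θ, hθ⟩
  have h := key θ
  rw [hθ] at h
  have h1 : (Subalgebra.toSubmodule
      (⊤ : Subalgebra ℤ (NumberField.RingOfIntegers K))).toAddSubgroup.index = 1 := by
    rw [Algebra.top_toSubmodule, Submodule.top_toAddSubgroup, AddSubgroup.index_top]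
  rw [h1] at h
  exact hp.one_lt.ne' (Nat.dvd_one.1 h)
end
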